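/- arXiv:2208.14283 — 6 statements merged into one kernel-verified Lean document; each statement's English description precedes it below -/
import Mathlib

section
/- Let F : ℝ^K → ℝ₊ be a nonnegative differentiable function, let t ∈ ℕ, L > 0, a₀ ∈ ℝ^K, set λ = 1/L and a_{k+1} = a_k − λ·(∇F)(a_k) for k ∈ {0,1,…,t−1}. Assume ‖(∇F)(a)‖ ≤ √(2·t·L·max{F(a₀),1}) for all a ∈ ℝ^K with ‖a − a₀‖ ≤ √(2·t·max{F(a₀),1}/L), and ‖(∇F)(a) − (∇F)(b)‖ ≤ L·‖a − b‖ for all a, b ∈ ℝ^K with ‖a − a₀‖ ≤ √(8·(t/L)·max{F(a₀),1}) and ‖b − a₀‖ ≤ √(8·(t/L)·max{F(a₀),1}). Then ‖a_k − a₀‖ ≤ √(2·(k/L)·(F(a₀) − F(a_k))) for all k ∈ {1,…,t}. -/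
open MeasureTheory Filter

noncomputable section

/-- The descent lemma: a differentiable function whose gradient is `L`-Lipschitz on a convex set
lies below its quadratic upper model there. -/
theorem le_quadratic_of_gradient_lipschitz {E : Type*} [NormedAddCommGroup E]
    [InnerProductSpace ℝ E] [CompleteSpace E] {F : E → ℝ} (hF : Differentiable ℝ F) {s : Set E}
    (hs : Convex ℝ s) {L : ℝ}
    (hlip : ∀ b ∈ s, ∀ c ∈ s, ‖gradient F b - gradient F c‖ ≤ L * ‖b - c‖)
    {x d : E} (hx : x ∈ s) (hxd : x + d ∈ s) :
    F (x + d) ≤ F x + inner ℝ (gradient F x) d + L / 2 * ‖d‖ ^ 2 := by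
  set g : ℝ → ℝ := fun r =>
    F (x + r • d) - r * inner ℝ (gradient F x) d - L / 2 * ‖d‖ ^ 2 * r ^ 2 with hg
  have hderiv (r : ℝ) : HasDerivAt g
      (inner ℝ (gradient F (x + r • d)) d - inner ℝ (gradient F x) d - L * ‖d‖ ^ 2 * r) r := by
    have hline : HasDerivAt (fun r : ℝ => x + r • d) d r := by
      simpa using ((hasDerivAt_id r).smul_const d).const_add x
    have hcomp := (hF (x + r • d)).hasGradientAt.hasFDerivAt.comp_hasDerivAt r hline
    rw [InnerProductSpace.toDual_apply_apply] at hcomp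
    have hlin := (hasDerivAt_id r).mul_const (inner ℝ (gradient F x) d)
    have hsq := ((hasDerivAt_id r).pow 2).const_mul (L / 2 * ‖d‖ ^ 2)
    refine ((hcomp.sub hlin).sub hsq).congr_deriv ?_
    simp only [id]
    ring
  have hanti : AntitoneOn g (Set.Icc 0 1) := by
    refine antitoneOn_of_deriv_nonpos (convex_Icc 0 1)
      (fun r _ => (hderiv r).continuousAt.continuousWithinAt)
      (fun r _ => (hderiv r).differentiableAt.differentiableWithinAt) fun r hr => ?_
    rw [interior_Icc] at hr
    rw [(hderiv r).deriv, ← inner_sub_left]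
    have hmem : x + r • d ∈ s := hs.add_smul_mem hx hxd ⟨hr.1.le, hr.2.le⟩
    have hgrad := hlip _ hmem _ hx
    rw [add_sub_cancel_left, norm_smul, Real.norm_of_nonneg hr.1.le] at hgrad
    have hinner := real_inner_le_norm (gradient F (x + r • d) - gradient F x) d
    nlinarith [mul_le_mul_of_nonneg_right hgrad (norm_nonneg d)]
  have h01 := hanti (Set.left_mem_Icc.2 zero_le_one) (Set.right_mem_Icc.2 zero_le_one) zero_le_one
  simp only [hg, one_smul, zero_smul, add_zero] at h01
  linarith

/-- A weighted form of the triangle inequality for squares. -/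
theorem add_sq_le_of_sq_le {n x y A B : ℝ} (hn : 0 ≤ n) (hA : 0 ≤ A)
    (hx : x ^ 2 ≤ n * A) (hy : y ^ 2 ≤ B) : (x + y) ^ 2 ≤ (n + 1) * (A + B) := by
  have hB : 0 ≤ B := (sq_nonneg y).trans hy
  have hcross : 2 * x * y ≤ n * B + A := by
    refine le_of_abs_le (abs_le_of_sq_le_sq ?_ (by positivity))
    nlinarith [mul_le_mul hx hy (sq_nonneg y) (mul_nonneg hn hA), sq_nonneg (n * B - A)]
  nlinarith

theorem gradient_descent_distance_bound
    (K : ℕ) (F : EuclideanSpace ℝ (Fin K) → ℝ)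
    (hFnonneg : ∀ a, 0 ≤ F a) (hFdiff : Differentiable ℝ F)
    (t : ℕ) (L : ℝ) (hL : 0 < L)
    (a : ℕ → EuclideanSpace ℝ (Fin K))
    (hstep : ∀ k, k < t → a (k + 1) = a k - (1 / L) • gradient F (a k))
    (hgradbound : ∀ b : EuclideanSpace ℝ (Fin K),
      ‖b - a 0‖ ≤ Real.sqrt (2 * t * max (F (a 0)) 1 / L) →
      ‖gradient F b‖ ≤ Real.sqrt (2 * t * L * max (F (a 0)) 1))
    (hgradlip : ∀ b c : EuclideanSpace ℝ (Fin K),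
      ‖b - a 0‖ ≤ Real.sqrt (8 * (t / L) * max (F (a 0)) 1) →
      ‖c - a 0‖ ≤ Real.sqrt (8 * (t / L) * max (F (a 0)) 1) →
      ‖gradient F b - gradient F c‖ ≤ L * ‖b - c‖) :
    ∀ k, 1 ≤ k → k ≤ t →
      ‖a k - a 0‖ ≤ Real.sqrt (2 * (k / L) * (F (a 0) - F (a k))) := by
  set M := max (F (a 0)) 1 with hM
  have hFM : F (a 0) ≤ M := le_max_left _ _
  have hMpos : 0 < M := lt_of_lt_of_le one_pos (le_max_right _ _)
  set R := Real.sqrt (2 * t * M / L) with hR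
  have hR0 : 0 ≤ R := Real.sqrt_nonneg _
  have hRsq : R ^ 2 = 2 * t * M / L := Real.sq_sqrt (by positivity)
  have hdouble : Real.sqrt (8 * (t / L) * M) = 2 * R := by
    rw [show 8 * (t / L) * M = (2 * R) ^ 2 by rw [mul_pow, hRsq]; ring]
    exact Real.sqrt_sq (by positivity)
  have hgradR : Real.sqrt (2 * t * L * M) = L * R := by
    rw [show 2 * t * L * M = (L * R) ^ 2 by rw [mul_pow, hRsq]; field_simp]
    exact Real.sqrt_sq (by positivity)
  rw [hgradR] at hgradbound
  rw [hdouble] at hgradlip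
  have hinv : ∀ k, k ≤ t →
      F (a k) ≤ F (a 0) ∧ ‖a k - a 0‖ ^ 2 ≤ k * (2 / L * (F (a 0) - F (a k))) := by
    intro k
    induction k with
    | zero => simp
    | succ k ih =>
      intro hk
      obtain ⟨hdec, hdist⟩ := ih (by omega)
      have hkt : (k : ℝ) ≤ t := by exact_mod_cast (by omega : k ≤ t)
      have hball : ‖a k - a 0‖ ≤ R := by
        refine Real.le_sqrt_of_sq_le (hdist.trans ?_)
        calc (k : ℝ) * (2 / L * (F (a 0) - F (a k))) ≤ t * (2 / L * M) := by
              have h₁ := hFnonneg (a k)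
              have h₂ : F (a 0) - F (a k) ≤ M := by linarith
              have h₃ : 0 ≤ F (a 0) - F (a k) := by linarith
              gcongr
          _ = 2 * t * M / L := by ring
      set v := gradient F (a k) with hv
      have hvR : ‖v‖ ≤ L * R := hgradbound _ hball
      have hnext : a (k + 1) = a k + -((1 / L) • v) := by
        rw [hstep k (by omega), sub_eq_add_neg]
      have hnorm : ‖-((1 / L) • v)‖ = ‖v‖ / L := by
        rw [norm_neg, norm_smul, Real.norm_of_nonneg (by positivity)]
        ring
      have hstepR : ‖v‖ / L ≤ R := by
        rw [div_le_iff₀ hL]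
        linarith
      have htri : ‖a (k + 1) - a 0‖ ≤ ‖a k - a 0‖ + ‖v‖ / L := by
        rw [hnext, add_sub_right_comm, ← hnorm]
        exact norm_add_le _ _
      have hdescent : F (a (k + 1)) ≤ F (a k) - ‖v‖ ^ 2 / (2 * L) := by
        have h := le_quadratic_of_gradient_lipschitz hFdiff (convex_closedBall (a 0) (2 * R))
          (L := L) (x := a k) (d := -((1 / L) • v))
          (fun b hb c hc => hgradlip b c (mem_closedBall_iff_norm.1 hb)
            (mem_closedBall_iff_norm.1 hc))
          (mem_closedBall_iff_norm.2 (by linarith))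
          (mem_closedBall_iff_norm.2 (by rw [← hnext]; linarith))
        rw [← hnext, hnorm, ← hv, inner_neg_right, real_inner_smul_right,
          real_inner_self_eq_norm_sq] at h
        refine h.trans_eq ?_
        field_simp
        ring
      have hsq : (‖v‖ / L) ^ 2 ≤ 2 / L * (F (a k) - F (a (k + 1))) := by
        calc (‖v‖ / L) ^ 2 = 2 / L * (‖v‖ ^ 2 / (2 * L)) := by field_simp
          _ ≤ 2 / L * (F (a k) - F (a (k + 1))) := by
              gcongr
              linarith
      refine ⟨hdescent.trans ((sub_le_self _ (by positivity)).trans hdec), ?_⟩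
      calc ‖a (k + 1) - a 0‖ ^ 2 ≤ (‖a k - a 0‖ + ‖v‖ / L) ^ 2 := by gcongr
        _ ≤ (k + 1) * (2 / L * (F (a 0) - F (a k)) + 2 / L * (F (a k) - F (a (k + 1)))) :=
            add_sq_le_of_sq_le k.cast_nonneg
              (mul_nonneg (by positivity) (sub_nonneg.2 hdec)) hdist hsq
        _ = ((k + 1 : ℕ) : ℝ) * (2 / L * (F (a 0) - F (a (k + 1)))) := by
            push_cast
            ring
  intro k _ hk
  refine Real.le_sqrt_of_sq_le ((hinv k hk).2.trans_eq ?_)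
  ring

end
end

section
/- Let F : ℝ^K → ℝ₊ be a nonnegative differentiable function, let t ∈ ℕ, L > 0, a₀ ∈ ℝ^K, set λ = 1/L and a_{k+1} = a_k − λ·(∇F)(a_k) for k ∈ {0,1,…,t−1}. Assume ‖(∇F)(a)‖ ≤ √(2·t·L·max{F(a₀),1}) for all a ∈ ℝ^K with ‖a − a₀‖ ≤ √(2·t·max{F(a₀),1}/L), and ‖(∇F)(a) − (∇F)(b)‖ ≤ L·‖a − b‖ for all a, b ∈ ℝ^K with ‖a − a₀‖ ≤ √(8·(t/L)·max{F(a₀),1}) and ‖b − a₀‖ ≤ √(8·(t/L)·max{F(a₀),1}). Then Σ_{k=0}^{s−1} ‖a_{k+1} − a_k‖² ≤ (2/L)·(F(a₀) − F(a_s)) for all s ∈ {1,…,t}. -/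
open MeasureTheory Filter

noncomputable section

/-- The descent lemma: a quadratic upper bound for a function whose gradient is Lipschitz
relative to the initial point along the segment from `x` to `x + v`. -/
theorem descent_lemma_of_segment {E : Type*} [NormedAddCommGroup E] [InnerProductSpace ℝ E]
    [CompleteSpace E] {F : E → ℝ} (hF : Differentiable ℝ F) {L : ℝ} {x v : E}
    (hlip : ∀ u ∈ Set.Icc (0 : ℝ) 1,
      ‖gradient F (x + u • v) - gradient F x‖ ≤ L * ‖u • v‖) :
    F (x + v) ≤ F x + inner ℝ (gradient F x) v + L / 2 * ‖v‖ ^ 2 := by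
  let φ : ℝ → ℝ := fun u =>
    F (x + u • v) - u * inner ℝ (gradient F x) v - L / 2 * ‖v‖ ^ 2 * u ^ 2
  have hφ (u : ℝ) : HasDerivAt φ (inner ℝ (gradient F (x + u • v)) v
      - inner ℝ (gradient F x) v - L * ‖v‖ ^ 2 * u) u := by
    have hline : HasDerivAt (fun u : ℝ => x + u • v) v u := by
      simpa using ((hasDerivAt_id u).smul_const v).const_add x
    have hcomp := (hF (x + u • v)).hasGradientAt.hasFDerivAt.comp_hasDerivAt u hline
    have hlin := (hasDerivAt_id u).mul_const (inner ℝ (gradient F x) v)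
    have hquad := ((hasDerivAt_id u).pow 2).const_mul (L / 2 * ‖v‖ ^ 2)
    refine ((hcomp.sub hlin).sub hquad).congr_deriv ?_
    simp
    ring
  have hanti : AntitoneOn φ (Set.Icc 0 1) := by
    refine antitoneOn_of_deriv_nonpos (convex_Icc 0 1)
      (fun u _ => (hφ u).continuousAt.continuousWithinAt)
      (fun u _ => (hφ u).differentiableAt.differentiableWithinAt) fun u hu => ?_
    have hu' : u ∈ Set.Icc (0 : ℝ) 1 := interior_subset hu
    rw [(hφ u).deriv, ← inner_sub_left, sub_nonpos]
    calc inner ℝ (gradient F (x + u • v) - gradient F x) v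
        ≤ ‖gradient F (x + u • v) - gradient F x‖ * ‖v‖ := real_inner_le_norm _ _
      _ ≤ L * ‖u • v‖ * ‖v‖ := by gcongr; exact hlip u hu'
      _ = L * ‖v‖ ^ 2 * u := by
        rw [norm_smul, Real.norm_of_nonneg hu'.1]
        ring
  have h01 := hanti (Set.left_mem_Icc.2 zero_le_one) (Set.right_mem_Icc.2 zero_le_one) zero_le_one
  simp only [φ, one_smul, zero_smul, add_zero] at h01
  linarith

/-- The squared displacement after `s` steps is at most `s` times the sum of the squared steps. -/
theorem norm_sub_sq_le_mul_sum_norm_sub_sq {E : Type*} [SeminormedAddCommGroup E]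
    (a : ℕ → E) (s : ℕ) :
    ‖a s - a 0‖ ^ 2 ≤ s * ∑ k ∈ Finset.range s, ‖a (k + 1) - a k‖ ^ 2 := by
  rw [← Finset.sum_range_sub]
  calc ‖∑ k ∈ Finset.range s, (a (k + 1) - a k)‖ ^ 2
      ≤ (∑ k ∈ Finset.range s, ‖a (k + 1) - a k‖) ^ 2 := by
        gcongr
        exact norm_sum_le _ _
    _ ≤ s * ∑ k ∈ Finset.range s, ‖a (k + 1) - a k‖ ^ 2 := by
        simpa using sq_sum_le_card_mul_sum_sq (s := Finset.range s)
          (f := fun k => ‖a (k + 1) - a k‖)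

theorem gradient_descent_step_sum_bound
    (K : ℕ) (F : EuclideanSpace ℝ (Fin K) → ℝ)
    (hFnonneg : ∀ a, 0 ≤ F a) (hFdiff : Differentiable ℝ F)
    (t : ℕ) (L : ℝ) (hL : 0 < L)
    (a : ℕ → EuclideanSpace ℝ (Fin K))
    (hstep : ∀ k, k < t → a (k + 1) = a k - (1 / L) • gradient F (a k))
    (hgradbound : ∀ b : EuclideanSpace ℝ (Fin K),
      ‖b - a 0‖ ≤ Real.sqrt (2 * t * max (F (a 0)) 1 / L) →
      ‖gradient F b‖ ≤ Real.sqrt (2 * t * L * max (F (a 0)) 1))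
    (hgradlip : ∀ b c : EuclideanSpace ℝ (Fin K),
      ‖b - a 0‖ ≤ Real.sqrt (8 * (t / L) * max (F (a 0)) 1) →
      ‖c - a 0‖ ≤ Real.sqrt (8 * (t / L) * max (F (a 0)) 1) →
      ‖gradient F b - gradient F c‖ ≤ L * ‖b - c‖) :
    ∀ s, 1 ≤ s → s ≤ t →
      ∑ k ∈ Finset.range s, ‖a (k + 1) - a k‖ ^ 2 ≤ (2 / L) * (F (a 0) - F (a s)) := by
  set M := max (F (a 0)) 1
  have hM : F (a 0) ≤ M := le_max_left _ _
  set R := Real.sqrt (2 * t * M / L)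
  have hR : 0 ≤ R := Real.sqrt_nonneg _
  have hgradR : Real.sqrt (2 * t * L * M) = L * R := by
    rw [show 2 * t * L * M = L ^ 2 * (2 * t * M / L) by field_simp,
      Real.sqrt_mul (sq_nonneg L), Real.sqrt_sq hL.le]
  have hlipR : Real.sqrt (8 * (t / L) * M) = 2 * R := by
    rw [show 8 * (t / L) * M = 2 ^ 2 * (2 * t * M / L) by ring,
      Real.sqrt_mul (by norm_num), Real.sqrt_sq (by norm_num)]
  rw [hgradR] at hgradbound
  rw [hlipR] at hgradlip
  suffices h : ∀ s, s ≤ t →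
      ∑ k ∈ Finset.range s, ‖a (k + 1) - a k‖ ^ 2 ≤ (2 / L) * (F (a 0) - F (a s)) from
    fun s _ hs => h s hs
  intro s
  induction s with
  | zero => simp
  | succ s ih =>
    intro hs
    have hsum := ih (by omega)
    have hst : (s : ℝ) ≤ t := by exact_mod_cast (by omega : s ≤ t)
    have hdist : ‖a s - a 0‖ ≤ R := by
      refine Real.le_sqrt_of_sq_le ((norm_sub_sq_le_mul_sum_norm_sub_sq a s).trans ?_)
      calc (s : ℝ) * ∑ k ∈ Finset.range s, ‖a (k + 1) - a k‖ ^ 2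
          ≤ t * ((2 / L) * M) := by
            gcongr
            refine hsum.trans ?_
            gcongr
            linarith [hFnonneg (a s)]
        _ = 2 * t * M / L := by ring
    set v := a (s + 1) - a s with hv
    have hgrad : gradient F (a s) = -(L • v) := by
      rw [hv, hstep s (by omega), sub_sub_cancel_left, smul_neg, neg_neg, smul_smul,
        mul_one_div_cancel hL.ne', one_smul]
    have hvR : ‖v‖ ≤ R := by
      have h := hgradbound (a s) hdist
      rw [hgrad, norm_neg, norm_smul, Real.norm_of_nonneg hL.le] at h
      exact le_of_mul_le_mul_left h hL
    have hdescent : F (a s + v) ≤ F (a s) + inner ℝ (gradient F (a s)) v + L / 2 * ‖v‖ ^ 2 := by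
      refine descent_lemma_of_segment hFdiff fun u hu => ?_
      have huv : ‖u • v‖ ≤ R := by
        rw [norm_smul, Real.norm_of_nonneg hu.1]
        exact (mul_le_of_le_one_left (norm_nonneg v) hu.2).trans hvR
      have hmem : ‖a s + u • v - a 0‖ ≤ 2 * R := by
        rw [add_sub_right_comm]
        exact (norm_add_le _ _).trans (by linarith)
      simpa using hgradlip (a s + u • v) (a s) hmem (by linarith)
    rw [hgrad, inner_neg_left, real_inner_smul_left, real_inner_self_eq_norm_sq,
      hv, add_sub_cancel, ← hv] at hdescent
    have hvsq : ‖v‖ ^ 2 ≤ (2 / L) * (F (a s) - F (a (s + 1))) := by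
      rw [div_mul_eq_mul_div, le_div_iff₀ hL]
      linarith
    rw [Finset.sum_range_succ]
    linarith

end
end

section
/- Let F : ℝ^K → ℝ₊ be a nonnegative differentiable function, let t ∈ ℕ, L > 0, a₀ ∈ ℝ^K, set λ = 1/L and a_{k+1} = a_k − λ·(∇F)(a_k) for k ∈ {0,1,…,t−1}. Assume ‖(∇F)(a)‖ ≤ √(2·t·L·max{F(a₀),1}) for all a ∈ ℝ^K with ‖a − a₀‖ ≤ √(2·t·max{F(a₀),1}/L), and ‖(∇F)(a) − (∇F)(b)‖ ≤ L·‖a − b‖ for all a, b ∈ ℝ^K with ‖a − a₀‖ ≤ √(8·(t/L)·max{F(a₀),1}) and ‖b − a₀‖ ≤ √(8·(t/L)·max{F(a₀),1}). Then F(a_k) ≤ F(a_{k−1}) − (1/(2L))·‖(∇F)(a_{k−1})‖² for all k ∈ {1,…,t}. -/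
open MeasureTheory Filter

noncomputable section

/-- A differentiable function on a real Hilbert space whose gradient is `L`-Lipschitz at `x` relative
to a convex set lies below its quadratic model at `x`. -/
theorem Convex.le_add_inner_gradient_add_sq {E : Type*} [NormedAddCommGroup E]
    [InnerProductSpace ℝ E] [CompleteSpace E] {F : E → ℝ} (hF : Differentiable ℝ F)
    {s : Set E} (hs : Convex ℝ s) {L : ℝ} {x y : E} (hx : x ∈ s) (hy : y ∈ s)
    (hlip : ∀ z ∈ s, ‖gradient F z - gradient F x‖ ≤ L * ‖z - x‖) :
    F y ≤ F x + inner ℝ (gradient F x) (y - x) + L / 2 * ‖y - x‖ ^ 2 := by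
  set v := y - x with hv
  have hderiv : ∀ r : ℝ, HasDerivAt
      (fun r : ℝ => F (x + r • v) - r * inner ℝ (gradient F x) v - L / 2 * ‖v‖ ^ 2 * r ^ 2)
      (inner ℝ (gradient F (x + r • v)) v - inner ℝ (gradient F x) v - L * ‖v‖ ^ 2 * r) r := by
    intro r
    have hline : HasDerivAt (fun r : ℝ => x + r • v) v r := by
      simpa using ((hasDerivAt_id r).smul_const v).const_add x
    have hcomp : HasDerivAt (fun r : ℝ => F (x + r • v)) (inner ℝ (gradient F (x + r • v)) v) r := by
      simpa [Function.comp_def] using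
        (hF (x + r • v)).hasGradientAt.hasFDerivAt.comp_hasDerivAt r hline
    have hlin := (hasDerivAt_id r).mul_const (inner ℝ (gradient F x) v)
    have hquad := (hasDerivAt_pow 2 r).const_mul (L / 2 * ‖v‖ ^ 2)
    refine ((hcomp.sub hlin).sub hquad).congr_deriv ?_
    push_cast
    ring
  have hanti := antitoneOn_of_deriv_nonpos (convex_Icc (0 : ℝ) 1)
    (fun r _ => (hderiv r).continuousAt.continuousWithinAt)
    (fun r _ => (hderiv r).differentiableAt.differentiableWithinAt) (fun r hr => by
      rw [interior_Icc] at hr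
      rw [(hderiv r).deriv, ← inner_sub_left]
      have hmem : x + r • v ∈ s := hs.add_smul_sub_mem hx hy ⟨hr.1.le, hr.2.le⟩
      have hz := hlip _ hmem
      rw [add_sub_cancel_left, norm_smul, Real.norm_of_nonneg hr.1.le] at hz
      have hcs := real_inner_le_norm (gradient F (x + r • v) - gradient F x) v
      nlinarith [mul_le_mul_of_nonneg_right hz (norm_nonneg v)])
  have h01 := hanti (Set.left_mem_Icc.2 zero_le_one) (Set.right_mem_Icc.2 zero_le_one) zero_le_one
  simp only [one_smul, zero_smul, hv, add_sub_cancel, add_zero] at h01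
  linarith

/-- The induction step of the Cauchy–Schwarz inequality for sums, in division-free form. -/
theorem add_sq_le_succ_mul_add {n S x p q : ℝ} (hn : 0 ≤ n) (hp : 0 ≤ p)
    (hS : S ^ 2 ≤ n * p) (hx : x ^ 2 ≤ q) : (S + x) ^ 2 ≤ (n + 1) * (p + q) := by
  have hq : 0 ≤ q := (sq_nonneg x).trans hx
  have hcross : 2 * S * x ≤ p + n * q := by
    refine le_of_abs_le (abs_le_of_sq_le_sq ?_ (by positivity))
    have hmul : S ^ 2 * x ^ 2 ≤ n * p * q := mul_le_mul hS hx (sq_nonneg x) (by positivity)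
    nlinarith [sq_nonneg (p - n * q)]
  linarith

theorem gradient_descent_descent_inequality
    (K : ℕ) (F : EuclideanSpace ℝ (Fin K) → ℝ)
    (hFnonneg : ∀ a, 0 ≤ F a) (hFdiff : Differentiable ℝ F)
    (t : ℕ) (L : ℝ) (hL : 0 < L)
    (a : ℕ → EuclideanSpace ℝ (Fin K))
    (hstep : ∀ k, k < t → a (k + 1) = a k - (1 / L) • gradient F (a k))
    (hgradbound : ∀ b : EuclideanSpace ℝ (Fin K),
      ‖b - a 0‖ ≤ Real.sqrt (2 * t * max (F (a 0)) 1 / L) →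
      ‖gradient F b‖ ≤ Real.sqrt (2 * t * L * max (F (a 0)) 1))
    (hgradlip : ∀ b c : EuclideanSpace ℝ (Fin K),
      ‖b - a 0‖ ≤ Real.sqrt (8 * (t / L) * max (F (a 0)) 1) →
      ‖c - a 0‖ ≤ Real.sqrt (8 * (t / L) * max (F (a 0)) 1) →
      ‖gradient F b - gradient F c‖ ≤ L * ‖b - c‖) :
    ∀ k, 1 ≤ k → k ≤ t →
      F (a k) ≤ F (a (k - 1)) - (1 / (2 * L)) * ‖gradient F (a (k - 1))‖ ^ 2 := by
  set M := max (F (a 0)) 1 with hM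
  have hM0 : 0 ≤ M := zero_le_one.trans (le_max_right _ _)
  set R := Real.sqrt (2 * t * M / L) with hR
  have hRsq : R ^ 2 = 2 * t * M / L := Real.sq_sqrt (by positivity)
  have hR0 : 0 ≤ R := Real.sqrt_nonneg _
  have hgradR : Real.sqrt (2 * t * L * M) = L * R := by
    rw [Real.sqrt_eq_iff_mul_self_eq (by positivity) (by positivity)]
    have : L * R * (L * R) = L ^ 2 * R ^ 2 := by ring
    rw [this, hRsq]
    field_simp
  have hlipR : Real.sqrt (8 * (t / L) * M) = 2 * R := by
    rw [Real.sqrt_eq_iff_mul_self_eq (by positivity) (by positivity)]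
    have : 2 * R * (2 * R) = 4 * R ^ 2 := by ring
    rw [this, hRsq]
    ring
  rw [hgradR] at hgradbound
  rw [hlipR] at hgradlip
  have hdescent : ∀ k < t, ‖a k - a 0‖ ≤ R →
      F (a (k + 1)) ≤ F (a k) - (1 / (2 * L)) * ‖gradient F (a k)‖ ^ 2 := by
    intro k hk hkR
    have hdiff : a (k + 1) - a k = -((1 / L) • gradient F (a k)) := by
      rw [hstep k hk]
      abel
    have hnorm : ‖a (k + 1) - a k‖ = 1 / L * ‖gradient F (a k)‖ := by
      rw [hdiff, norm_neg, norm_smul, Real.norm_of_nonneg (by positivity)]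
    have hstepR : ‖a (k + 1) - a k‖ ≤ R := by
      rw [hnorm, one_div, inv_mul_le_iff₀ hL]
      exact hgradbound _ hkR
    have hk2R : ‖a k - a 0‖ ≤ 2 * R := by linarith
    have hnext : ‖a (k + 1) - a 0‖ ≤ 2 * R := by
      linarith [norm_sub_le_norm_sub_add_norm_sub (a (k + 1)) (a k) (a 0)]
    have hquad := (convex_closedBall (a 0) (2 * R)).le_add_inner_gradient_add_sq hFdiff
      (mem_closedBall_iff_norm.2 hk2R) (mem_closedBall_iff_norm.2 hnext)
      (fun z hz => hgradlip z (a k) (mem_closedBall_iff_norm.1 hz) hk2R)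
    rw [hnorm, hdiff, inner_neg_right, real_inner_smul_right, real_inner_self_eq_norm_sq] at hquad
    refine hquad.trans_eq ?_
    field_simp
    ring
  have hradius : ∀ k : ℕ, k ≤ t → ‖a k - a 0‖ ^ 2 ≤ k * (2 / L * (F (a 0) - F (a k))) →
      ‖a k - a 0‖ ≤ R := by
    intro k hk hdist
    refine Real.le_sqrt_of_sq_le (hdist.trans ?_)
    have hgap : F (a 0) - F (a k) ≤ M := by linarith [hFnonneg (a k), le_max_left (F (a 0)) 1]
    calc (k : ℝ) * (2 / L * (F (a 0) - F (a k))) ≤ k * (2 / L * M) := by gcongr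
      _ ≤ t * (2 / L * M) := by gcongr
      _ = 2 * t * M / L := by ring
  have hdist : ∀ k ≤ t, F (a k) ≤ F (a 0) ∧
      ‖a k - a 0‖ ^ 2 ≤ k * (2 / L * (F (a 0) - F (a k))) := by
    intro k
    induction k with
    | zero => simp
    | succ k ih =>
      intro hk
      obtain ⟨hle, hsq⟩ := ih (by omega)
      have hdesc := hdescent k hk (hradius k (by omega) hsq)
      have hgrad : 0 ≤ (1 / (2 * L)) * ‖gradient F (a k)‖ ^ 2 := by positivity
      refine ⟨by linarith, ?_⟩
      have hnorm : ‖a (k + 1) - a k‖ = 1 / L * ‖gradient F (a k)‖ := by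
        rw [hstep k hk, sub_sub_cancel_left, norm_neg, norm_smul,
          Real.norm_of_nonneg (by positivity)]
      have hinc : ‖a (k + 1) - a k‖ ^ 2 ≤ 2 / L * (F (a k) - F (a (k + 1))) := by
        calc ‖a (k + 1) - a k‖ ^ 2
            = 2 / L * ((1 / (2 * L)) * ‖gradient F (a k)‖ ^ 2) := by rw [hnorm]; field_simp
          _ ≤ 2 / L * (F (a k) - F (a (k + 1))) := by gcongr; linarith
      have hgap : 0 ≤ 2 / L * (F (a 0) - F (a k)) := mul_nonneg (by positivity) (by linarith)
      calc ‖a (k + 1) - a 0‖ ^ 2 ≤ (‖a k - a 0‖ + ‖a (k + 1) - a k‖) ^ 2 := by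
            gcongr
            linarith [norm_sub_le_norm_sub_add_norm_sub (a (k + 1)) (a k) (a 0)]
        _ ≤ _ := add_sq_le_succ_mul_add k.cast_nonneg hgap hsq hinc
        _ = _ := by push_cast; ring
  intro k hk1 hkt
  obtain ⟨k, rfl⟩ := Nat.exists_eq_add_of_le' hk1
  exact hdescent k hkt (hradius k (by omega) (hdist k (by omega)).2)

end
end

section
/- Let σ : ℝ → ℝ be bounded and differentiable with bounded derivative, and fix data points (X₁,Y₁),…,(X_n,Y_n) ∈ ℝ^d × ℝ. Let α_n ≥ 1, t_n ≥ L_n > 0, γ*_n ≥ 1, B_n ≥ 1, r ≥ 2d, and let w, v be weight vectors such that |w^{(L)}_{1,1,k}| ≤ γ*_n for k = 1,…,K_n, |w^{(l)}_{k,i,j}| ≤ B_n for l = 1,…,L−1, and ‖w − v‖_∞² ≤ (2t_n/L_n)·max{F_n(v),1}. Then there exists a constant c₅ > 0, depending only on d, r, L, σ and c₂, such that ‖(∇_w F_n)(w)‖ ≤ c₅ · K_n^{3/2} · B_n^{2L} · (γ*_n)² · α_n² · √((t_n/L_n)·max{F_n(v),1}). -/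
open MeasureTheory ProbabilityTheory Filter

noncomputable section

/-- The logistic squasher `σ(x) = 1/(1+e^{-x})`. -/
def sigLog : ℝ → ℝ := fun x => 1 / (1 + Real.exp (-x))

/-- Index type for the weights of a linear combination of `Kn` fully connected deep networks
with `L` layers, `r` neurons per layer and input dimension `d`:
`Sum.inl (k, i, j)` is the level-0 weight `w^{(0)}_{k,i+1,j}` (`j = 0` is the bias,
`j = t+1` multiplies `x^{(t+1)}`); `Sum.inr (Sum.inl (k, m, i, j))` is the inner weight
`w^{(m+1)}_{k,i+1,j}` for the levels `m+1 ∈ {1,…,L-1}` (`j = 0` is the bias, `j = t+1`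
multiplies the output of neuron `t+1`); `Sum.inr (Sum.inr j)` is the output weight
`w^{(L)}_{1,1,j+1}`. -/
abbrev Idx (Kn L r d : ℕ) : Type :=
  (Fin Kn × Fin r × Fin (d + 1)) ⊕ ((Fin Kn × Fin (L - 1) × Fin r × Fin (r + 1)) ⊕ Fin Kn)

/-- `hid σ Kn L r d w k m i x` is the output `f^{(m+1)}_{k,i+1}(x)` of neuron `i+1` in
layer `m+1` of the `k`-th fully connected subnetwork. -/
def hid (σ : ℝ → ℝ) (Kn L r d : ℕ) (w : EuclideanSpace ℝ (Idx Kn L r d)) (k : Fin Kn) :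
    ℕ → Fin r → (Fin d → ℝ) → ℝ
  | 0 => fun i x =>
      σ ((∑ j : Fin d, w (Sum.inl (k, i, j.succ)) * x j) + w (Sum.inl (k, i, 0)))
  | (m + 1) => fun i x =>
      σ ((∑ j : Fin r,
            (if h : m < L - 1 then w (Sum.inr (Sum.inl (k, ⟨m, h⟩, i, j.succ))) else 0) *
              hid σ Kn L r d w k m j x) +
          (if h : m < L - 1 then w (Sum.inr (Sum.inl (k, ⟨m, h⟩, i, 0))) else 0))

/-- Output `f^{(L)}_{k,1}` of the `k`-th fully connected subnetwork. -/
def subnet (σ : ℝ → ℝ) (Kn L r d : ℕ) (w : EuclideanSpace ℝ (Idx Kn L r d)) (k : Fin Kn)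
    (x : Fin d → ℝ) : ℝ :=
  if h : 0 < r then hid σ Kn L r d w k (L - 1) ⟨0, h⟩ x else 0

/-- The deep network `f_w(x) = ∑_{j=1}^{K_n} w^{(L)}_{1,1,j} · f^{(L)}_{j,1}(x)`. -/
def netF (σ : ℝ → ℝ) (Kn L r d : ℕ) (w : EuclideanSpace ℝ (Idx Kn L r d))
    (x : Fin d → ℝ) : ℝ :=
  ∑ j : Fin Kn, w (Sum.inr (Sum.inr j)) * subnet σ Kn L r d w j x

/-- Indicator function of the cube `[-α,α]^d`. -/
def cubeInd (d : ℕ) (α : ℝ) (x : Fin d → ℝ) : ℝ :=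
  Set.indicator {y : Fin d → ℝ | ∀ j, |y j| ≤ α} (fun _ => (1 : ℝ)) x

/-- The regularized empirical L₂ risk
`F_n(w) = (1/n) ∑_i |f_w(X_i) - Y_i|² 1_{[-α_n,α_n]^d}(X_i) + c₂ ∑_j |w^{(L)}_{1,1,j}|²`. -/
def empRisk (σ : ℝ → ℝ) (Kn L r d n : ℕ) (X : Fin n → Fin d → ℝ) (Y : Fin n → ℝ)
    (αn c2 : ℝ) (w : EuclideanSpace ℝ (Idx Kn L r d)) : ℝ :=
  (1 / (n : ℝ)) * ∑ i : Fin n, (netF σ Kn L r d w (X i) - Y i) ^ 2 * cubeInd d αn (X i)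
    + c2 * ∑ j : Fin Kn, (w (Sum.inr (Sum.inr j))) ^ 2

/-- Truncation operator `T_β z = max{-β, min{β, z}}`. -/
def Tbeta (β z : ℝ) : ℝ := max (-β) (min β z)

/-- The weight `w^{(m+1)}_{k,i+1,j}` as a continuous linear functional of `w`, equal to `0` for
levels beyond the depth of the network. -/
def layerWeight {Kn L r d : ℕ} (k : Fin Kn) (m : ℕ) (i : Fin r) (j : Fin (r + 1)) :
    EuclideanSpace ℝ (Idx Kn L r d) →L[ℝ] ℝ :=
  if h : m < L - 1 then EuclideanSpace.proj (Sum.inr (Sum.inl (k, ⟨m, h⟩, i, j))) else 0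

/-- The `ℓ¹`-norm of the weights of the `k`-th subnetwork. -/
def subnetNorm {Kn L r d : ℕ} (k : Fin Kn) (h : EuclideanSpace ℝ (Idx Kn L r d)) : ℝ :=
  ∑ p : Fin r × Fin (d + 1), |h (Sum.inl (k, p))| +
    ∑ p : Fin (L - 1) × Fin r × Fin (r + 1), |h (Sum.inr (Sum.inl (k, p)))|

/-- The constant in the bound on the derivative of a neuron in layer `m + 1`. -/
def neuronConst (S M : ℝ) (r : ℕ) : ℕ → ℝ
  | 0 => S
  | m + 1 => S * (M + r * neuronConst S M r m)

lemma neuronConst_nonneg {S M : ℝ} (hS : 0 ≤ S) (hM : 0 ≤ M) (r m : ℕ) :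
    0 ≤ neuronConst S M r m := by
  induction m with
  | zero => exact hS
  | succ m ih => rw [neuronConst]; positivity

section

variable {Kn L r d : ℕ}

lemma hasFDerivAt_coord {ι : Type*} [Fintype ι] (a : ι) (w : EuclideanSpace ℝ ι) :
    HasFDerivAt (fun u : EuclideanSpace ℝ ι => u a)
      (EuclideanSpace.proj a : EuclideanSpace ℝ ι →L[ℝ] ℝ) w :=
  (EuclideanSpace.proj a : EuclideanSpace ℝ ι →L[ℝ] ℝ).hasFDerivAt

lemma subnetNorm_nonneg (k : Fin Kn) (h : EuclideanSpace ℝ (Idx Kn L r d)) :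
    0 ≤ subnetNorm k h := by
  unfold subnetNorm; positivity

lemma hid_zero (σ : ℝ → ℝ) (w : EuclideanSpace ℝ (Idx Kn L r d)) (k : Fin Kn) (i : Fin r)
    (x : Fin d → ℝ) :
    hid σ Kn L r d w k 0 i x =
      σ ((∑ j : Fin d, w (Sum.inl (k, i, j.succ)) * x j) + w (Sum.inl (k, i, 0))) := rfl

lemma hid_succ (σ : ℝ → ℝ) (w : EuclideanSpace ℝ (Idx Kn L r d)) (k : Fin Kn) (m : ℕ)
    (i : Fin r) (x : Fin d → ℝ) :
    hid σ Kn L r d w k (m + 1) i x =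
      σ ((∑ j : Fin r, layerWeight k m i j.succ w * hid σ Kn L r d w k m j x) +
        layerWeight k m i 0 w) := by
  rw [hid]
  by_cases h : m < L - 1 <;> simp [layerWeight, h]

lemma abs_hid_le {σ : ℝ → ℝ} {M : ℝ} (hM : ∀ x, |σ x| ≤ M)
    (w : EuclideanSpace ℝ (Idx Kn L r d)) (k : Fin Kn) (m : ℕ) (i : Fin r) (x : Fin d → ℝ) :
    |hid σ Kn L r d w k m i x| ≤ M := by
  cases m <;> exact hM _

lemma abs_subnet_le {σ : ℝ → ℝ} {M : ℝ} (hM : ∀ x, |σ x| ≤ M)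
    (w : EuclideanSpace ℝ (Idx Kn L r d)) (k : Fin Kn) (x : Fin d → ℝ) :
    |subnet σ Kn L r d w k x| ≤ M := by
  unfold subnet
  split_ifs
  · exact abs_hid_le hM w k _ _ x
  · simpa using (abs_nonneg _).trans (hM 0)

lemma abs_netF_le {σ : ℝ → ℝ} {M γ : ℝ} (hM : ∀ x, |σ x| ≤ M)
    (w : EuclideanSpace ℝ (Idx Kn L r d)) (hw : ∀ k, |w (Sum.inr (Sum.inr k))| ≤ γ)
    (x : Fin d → ℝ) :
    |netF σ Kn L r d w x| ≤ Kn * (γ * M) := by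
  calc |netF σ Kn L r d w x| ≤ ∑ j, |w (Sum.inr (Sum.inr j)) * subnet σ Kn L r d w j x| :=
        Finset.abs_sum_le_sum_abs _ _
    _ ≤ ∑ _j : Fin Kn, γ * M := by
        refine Finset.sum_le_sum fun j _ => ?_
        rw [abs_mul]
        exact mul_le_mul (hw j) (abs_subnet_le hM w j x) (abs_nonneg _)
          ((abs_nonneg _).trans (hw j))
    _ = Kn * (γ * M) := by simp

lemma sum_abs_inl_le_subnetNorm (k : Fin Kn) (i : Fin r)
    (h : EuclideanSpace ℝ (Idx Kn L r d)) :
    ∑ j : Fin (d + 1), |h (Sum.inl (k, i, j))| ≤ subnetNorm k h := by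
  unfold subnetNorm
  rw [Fintype.sum_prod_type]
  have := Finset.single_le_sum
    (f := fun i : Fin r => ∑ j : Fin (d + 1), |h (Sum.inl (k, i, j))|)
    (fun _ _ => by positivity) (Finset.mem_univ i)
  have : 0 ≤ ∑ p : Fin (L - 1) × Fin r × Fin (r + 1), |h (Sum.inr (Sum.inl (k, p)))| := by
    positivity
  linarith

lemma sum_abs_layerWeight_le_subnetNorm (k : Fin Kn) (m : ℕ) (i : Fin r)
    (h : EuclideanSpace ℝ (Idx Kn L r d)) :
    ∑ j : Fin (r + 1), |layerWeight k m i j h| ≤ subnetNorm k h := by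
  by_cases hm : m < L - 1
  · simp only [layerWeight, hm, dite_true, PiLp.proj_apply]
    unfold subnetNorm
    simp_rw [Fintype.sum_prod_type (γ := ℝ) (α₁ := Fin (L - 1)),
      Fintype.sum_prod_type (γ := ℝ) (α₁ := Fin r) (α₂ := Fin (r + 1))]
    have h1 := Finset.single_le_sum
      (f := fun i : Fin r => ∑ j : Fin (r + 1), |h (Sum.inr (Sum.inl (k, ⟨m, hm⟩, i, j)))|)
      (fun _ _ => by positivity) (Finset.mem_univ i)
    have h2 := Finset.single_le_sum
      (f := fun l : Fin (L - 1) =>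
        ∑ i : Fin r, ∑ j : Fin (r + 1), |h (Sum.inr (Sum.inl (k, l, i, j)))|)
      (fun _ _ => by positivity) (Finset.mem_univ (⟨m, hm⟩ : Fin (L - 1)))
    have h3 : 0 ≤ ∑ p : Fin r × Fin (d + 1), |h (Sum.inl (k, p))| := by positivity
    simp only at h1 h2
    linarith
  · simpa [layerWeight, hm] using subnetNorm_nonneg k h

lemma sum_subnetNorm_add (h : EuclideanSpace ℝ (Idx Kn L r d)) :
    ∑ k, (subnetNorm k h + |h (Sum.inr (Sum.inr k))|) = ∑ idx, |h idx| := by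
  simp only [subnetNorm, Finset.sum_add_distrib, Fintype.sum_sum_type,
    Fintype.sum_prod_type (α₁ := Fin Kn)]
  ring

lemma abs_layerWeight_le {B : ℝ} (hB : 0 ≤ B) (w : EuclideanSpace ℝ (Idx Kn L r d))
    (hw : ∀ (k : Fin Kn) (l : Fin (L - 1)) (i : Fin r) (j : Fin (r + 1)),
      |w (Sum.inr (Sum.inl (k, l, i, j)))| ≤ B)
    (k : Fin Kn) (m : ℕ) (i : Fin r) (j : Fin (r + 1)) :
    |layerWeight k m i j w| ≤ B := by
  by_cases hm : m < L - 1
  · simpa [layerWeight, hm] using hw k ⟨m, hm⟩ i j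
  · simpa [layerWeight, hm] using hB

lemma exists_hasFDerivAt_hid {σ : ℝ → ℝ} (hσ : Differentiable ℝ σ) {M S B α : ℝ}
    (hM : ∀ x, |σ x| ≤ M) (hS : ∀ x, |deriv σ x| ≤ S) (hM1 : 1 ≤ M) (hB : 1 ≤ B) (hα : 1 ≤ α)
    (w : EuclideanSpace ℝ (Idx Kn L r d))
    (hw : ∀ (k : Fin Kn) (l : Fin (L - 1)) (i : Fin r) (j : Fin (r + 1)),
      |w (Sum.inr (Sum.inl (k, l, i, j)))| ≤ B)
    (k : Fin Kn) (x : Fin d → ℝ) (hx : ∀ j, |x j| ≤ α) (m : ℕ) (i : Fin r) :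
    ∃ D : EuclideanSpace ℝ (Idx Kn L r d) →L[ℝ] ℝ,
      HasFDerivAt (fun u => hid σ Kn L r d u k m i x) D w ∧
      ∀ h, |D h| ≤ neuronConst S M r m * B ^ m * α * subnetNorm k h := by
  have hS0 : 0 ≤ S := (abs_nonneg _).trans (hS 0)
  induction m generalizing i with
  | zero =>
    refine ⟨_, (hσ _).hasDerivAt.comp_hasFDerivAt w
      ((HasFDerivAt.fun_sum (u := Finset.univ) (A := fun j (u : EuclideanSpace ℝ (Idx Kn L r d)) =>
          u (Sum.inl (k, i, j.succ)) * x j)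
        fun j _ => (hasFDerivAt_coord (Sum.inl (k, i, Fin.succ j)) w).mul_const (x j)).add
        (hasFDerivAt_coord (Sum.inl (k, i, 0)) w)), fun h => ?_⟩
    have hsum := sum_abs_inl_le_subnetNorm k i h
    rw [Fin.sum_univ_succ] at hsum
    simp only [smul_apply, add_apply,
      sum_apply, smul_eq_mul, PiLp.proj_apply, abs_mul,
      neuronConst, pow_zero, mul_one, mul_assoc]
    refine mul_le_mul (hS _) ?_ (abs_nonneg _) hS0
    calc |∑ j : Fin d, x j * h (Sum.inl (k, i, j.succ)) + h (Sum.inl (k, i, 0))|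
        ≤ ∑ j : Fin d, |x j * h (Sum.inl (k, i, j.succ))| + |h (Sum.inl (k, i, 0))| :=
          (abs_add_le _ _).trans (add_le_add_left (Finset.abs_sum_le_sum_abs _ _) _)
      _ ≤ ∑ j : Fin d, α * |h (Sum.inl (k, i, j.succ))| + α * |h (Sum.inl (k, i, 0))| := by
          refine add_le_add (Finset.sum_le_sum fun j _ => ?_)
            (le_mul_of_one_le_left (abs_nonneg _) hα)
          rw [abs_mul]
          exact mul_le_mul_of_nonneg_right (hx j) (abs_nonneg _)
      _ = α * (|h (Sum.inl (k, i, 0))| + ∑ j : Fin d, |h (Sum.inl (k, i, j.succ))|) := by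
          rw [← Finset.mul_sum]; ring
      _ ≤ α * subnetNorm k h := by gcongr
  | succ m ih =>
    choose D hD hDle using ih
    simp only [hid_succ]
    refine ⟨_, (hσ _).hasDerivAt.comp_hasFDerivAt w
      ((HasFDerivAt.fun_sum (u := Finset.univ)
        (A := fun j u => layerWeight k m i j.succ u * hid σ Kn L r d u k m j x)
        fun j _ => ((layerWeight k m i (Fin.succ j)).hasFDerivAt (x := w)).mul (hD j)).add
        (layerWeight k m i 0).hasFDerivAt), fun h => ?_⟩
    have hsum := sum_abs_layerWeight_le_subnetNorm k m i h
    rw [Fin.sum_univ_succ] at hsum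
    have hC := neuronConst_nonneg hS0 (zero_le_one.trans hM1) r m
    have hN := subnetNorm_nonneg k h
    simp only [smul_apply, add_apply,
      sum_apply, smul_eq_mul, abs_mul, neuronConst]
    rw [mul_assoc S, mul_assoc S, mul_assoc S]
    refine mul_le_mul (hS _) ?_ (abs_nonneg _) hS0
    set E := neuronConst S M r m * B ^ m * α * subnetNorm k h with hE
    calc |∑ j : Fin r, (layerWeight k m i j.succ w * D j h +
            hid σ Kn L r d w k m j x * layerWeight k m i j.succ h) + layerWeight k m i 0 h|
        ≤ ∑ j : Fin r, |layerWeight k m i j.succ w * D j h +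
            hid σ Kn L r d w k m j x * layerWeight k m i j.succ h| + |layerWeight k m i 0 h| :=
          (abs_add_le _ _).trans (add_le_add_left (Finset.abs_sum_le_sum_abs _ _) _)
      _ ≤ ∑ j : Fin r, (B * E + M * |layerWeight k m i j.succ h|) +
            M * |layerWeight k m i 0 h| := by
          refine add_le_add (Finset.sum_le_sum fun j _ => (abs_add_le _ _).trans ?_)
            (le_mul_of_one_le_left (abs_nonneg _) hM1)
          rw [abs_mul, abs_mul]
          exact add_le_add (mul_le_mul
              (abs_layerWeight_le (by linarith) w hw k m i _) (hDle j h) (abs_nonneg _)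
              (by linarith))
            (mul_le_mul_of_nonneg_right (abs_hid_le hM w k m j x) (abs_nonneg _))
      _ = r * (B * E) +
            M * (|layerWeight k m i 0 h| + ∑ j : Fin r, |layerWeight k m i j.succ h|) := by
          rw [Finset.sum_add_distrib, ← Finset.mul_sum Finset.univ _ M]
          simp only [Finset.sum_const, Finset.card_univ, Fintype.card_fin, nsmul_eq_mul]
          ring
      _ ≤ r * (B * E) + M * (B ^ (m + 1) * α) * subnetNorm k h := by
          have : M * 1 ≤ M * (B ^ (m + 1) * α) := by
            gcongr
            exact one_le_mul_of_one_le_of_one_le (one_le_pow₀ hB) hα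
          rw [mul_one] at this
          gcongr
      _ = (M + r * neuronConst S M r m) * B ^ (m + 1) * α * subnetNorm k h := by
          rw [hE]; ring

lemma exists_hasFDerivAt_subnet {σ : ℝ → ℝ} (hσ : Differentiable ℝ σ) {M S B α : ℝ}
    (hM : ∀ x, |σ x| ≤ M) (hS : ∀ x, |deriv σ x| ≤ S) (hM1 : 1 ≤ M) (hB : 1 ≤ B) (hα : 1 ≤ α)
    (w : EuclideanSpace ℝ (Idx Kn L r d))
    (hw : ∀ (k : Fin Kn) (l : Fin (L - 1)) (i : Fin r) (j : Fin (r + 1)),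
      |w (Sum.inr (Sum.inl (k, l, i, j)))| ≤ B)
    (k : Fin Kn) (x : Fin d → ℝ) (hx : ∀ j, |x j| ≤ α) :
    ∃ D : EuclideanSpace ℝ (Idx Kn L r d) →L[ℝ] ℝ,
      HasFDerivAt (fun u => subnet σ Kn L r d u k x) D w ∧
      ∀ h, |D h| ≤ neuronConst S M r (L - 1) * B ^ (L - 1) * α * subnetNorm k h := by
  by_cases hr : 0 < r
  · simpa only [subnet, hr, dite_true] using
      exists_hasFDerivAt_hid hσ hM hS hM1 hB hα w hw k x hx (L - 1) ⟨0, hr⟩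
  · refine ⟨0, by simpa only [subnet, hr, dite_false] using hasFDerivAt_const 0 w, fun h => ?_⟩
    have := neuronConst_nonneg ((abs_nonneg _).trans (hS 0)) (zero_le_one.trans hM1) r (L - 1)
    have := subnetNorm_nonneg k h
    rw [zero_apply, abs_zero]
    positivity

lemma exists_hasFDerivAt_netF {σ : ℝ → ℝ} (hσ : Differentiable ℝ σ) {M S B α γ : ℝ}
    (hM : ∀ x, |σ x| ≤ M) (hS : ∀ x, |deriv σ x| ≤ S) (hM1 : 1 ≤ M) (hB : 1 ≤ B) (hα : 1 ≤ α)
    (hγ : 1 ≤ γ) (w : EuclideanSpace ℝ (Idx Kn L r d))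
    (hwγ : ∀ k, |w (Sum.inr (Sum.inr k))| ≤ γ)
    (hw : ∀ (k : Fin Kn) (l : Fin (L - 1)) (i : Fin r) (j : Fin (r + 1)),
      |w (Sum.inr (Sum.inl (k, l, i, j)))| ≤ B)
    (x : Fin d → ℝ) (hx : ∀ j, |x j| ≤ α) :
    ∃ D : EuclideanSpace ℝ (Idx Kn L r d) →L[ℝ] ℝ,
      HasFDerivAt (fun u => netF σ Kn L r d u x) D w ∧
      ∀ h, |D h| ≤ (neuronConst S M r (L - 1) + M) * B ^ (L - 1) * α * γ * ∑ idx, |h idx| := by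
  have hC := neuronConst_nonneg ((abs_nonneg _).trans (hS 0)) (zero_le_one.trans hM1) r (L - 1)
  choose D hD hDle using fun k => exists_hasFDerivAt_subnet hσ hM hS hM1 hB hα w hw k x hx
  refine ⟨_, HasFDerivAt.fun_sum (u := Finset.univ)
    (A := fun k (u : EuclideanSpace ℝ (Idx Kn L r d)) =>
      u (Sum.inr (Sum.inr k)) * subnet σ Kn L r d u k x)
    fun k _ => (hasFDerivAt_coord (Sum.inr (Sum.inr k)) w).mul (hD k), fun h => ?_⟩
  simp only [smul_apply, add_apply, sum_apply, smul_eq_mul, PiLp.proj_apply]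
  rw [← sum_subnetNorm_add, Finset.mul_sum]
  refine (Finset.abs_sum_le_sum_abs _ _).trans (Finset.sum_le_sum fun k _ => ?_)
  have hN := subnetNorm_nonneg k h
  set C := neuronConst S M r (L - 1)
  calc |w (Sum.inr (Sum.inr k)) * D k h + subnet σ Kn L r d w k x * h (Sum.inr (Sum.inr k))|
      ≤ γ * (C * B ^ (L - 1) * α * subnetNorm k h) + M * |h (Sum.inr (Sum.inr k))| := by
        refine (abs_add_le _ _).trans ?_
        rw [abs_mul, abs_mul]
        exact add_le_add (mul_le_mul (hwγ k) (hDle k h) (abs_nonneg _) (by linarith))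
          (mul_le_mul_of_nonneg_right (abs_subnet_le hM w k x) (abs_nonneg _))
    _ ≤ ((C + M) * B ^ (L - 1) * α * γ) * subnetNorm k h +
          ((C + M) * B ^ (L - 1) * α * γ) * |h (Sum.inr (Sum.inr k))| := by
        have h1 : 1 ≤ B ^ (L - 1) * α * γ :=
          one_le_mul_of_one_le_of_one_le
            (one_le_mul_of_one_le_of_one_le (one_le_pow₀ hB) hα) hγ
        have h2 : γ * (C * B ^ (L - 1) * α * subnetNorm k h) ≤
            ((C + M) * B ^ (L - 1) * α * γ) * subnetNorm k h := by
          have : 0 ≤ M * (B ^ (L - 1) * α * γ) * subnetNorm k h := by positivity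
          linarith
        have h3 : M ≤ (C + M) * B ^ (L - 1) * α * γ := by
          have : (C + M) * 1 ≤ (C + M) * (B ^ (L - 1) * α * γ) := by gcongr
          linarith
        gcongr
    _ = _ := by ring

lemma sum_abs_le_sqrt_card_mul_norm {ι : Type*} [Fintype ι] (h : EuclideanSpace ℝ ι) :
    ∑ i, |h i| ≤ √(Fintype.card ι) * ‖h‖ := by
  rw [EuclideanSpace.norm_eq, ← Real.sqrt_mul (Nat.cast_nonneg _)]
  apply Real.le_sqrt_of_sq_le
  simpa using sq_sum_le_card_mul_sum_sq (s := Finset.univ) (f := fun i => |h i|)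

lemma cubeInd_of_mem {α : ℝ} {x : Fin d → ℝ} (hx : ∀ j, |x j| ≤ α) : cubeInd d α x = 1 :=
  Set.indicator_of_mem (s := {y : Fin d → ℝ | ∀ j, |y j| ≤ α}) hx _

lemma cubeInd_of_notMem {α : ℝ} {x : Fin d → ℝ} (hx : ¬ ∀ j, |x j| ≤ α) :
    cubeInd d α x = 0 :=
  Set.indicator_of_notMem (s := {y : Fin d → ℝ | ∀ j, |y j| ≤ α}) hx _

lemma cubeInd_nonneg (α : ℝ) (x : Fin d → ℝ) : 0 ≤ cubeInd d α x := by
  by_cases hx : ∀ j, |x j| ≤ α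
  · simp [cubeInd_of_mem hx]
  · simp [cubeInd_of_notMem hx]

lemma sq_cubeInd (α : ℝ) (x : Fin d → ℝ) : cubeInd d α x ^ 2 = cubeInd d α x := by
  by_cases hx : ∀ j, |x j| ≤ α
  · simp [cubeInd_of_mem hx]
  · simp [cubeInd_of_notMem hx]

lemma exists_hasFDerivAt_empRisk {σ : ℝ → ℝ} (hσ : Differentiable ℝ σ) {M S B α γ c2 : ℝ}
    (hM : ∀ x, |σ x| ≤ M) (hS : ∀ x, |deriv σ x| ≤ S) (hM1 : 1 ≤ M) (hB : 1 ≤ B) (hα : 1 ≤ α)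
    (hγ : 1 ≤ γ) (hc2 : 0 < c2) (w : EuclideanSpace ℝ (Idx Kn L r d))
    (hwγ : ∀ k, |w (Sum.inr (Sum.inr k))| ≤ γ)
    (hw : ∀ (k : Fin Kn) (l : Fin (L - 1)) (i : Fin r) (j : Fin (r + 1)),
      |w (Sum.inr (Sum.inl (k, l, i, j)))| ≤ B)
    {n : ℕ} (X : Fin n → Fin d → ℝ) (Y : Fin n → ℝ) :
    ∃ D : EuclideanSpace ℝ (Idx Kn L r d) →L[ℝ] ℝ,
      HasFDerivAt (empRisk σ Kn L r d n X Y α c2) D w ∧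
      ∀ h, |D h| ≤ (2 * ((1 / (n : ℝ)) * ∑ i, |netF σ Kn L r d w (X i) - Y i| *
          cubeInd d α (X i)) * ((neuronConst S M r (L - 1) + M) * B ^ (L - 1) * α * γ) +
          2 * c2 * γ) * ∑ idx, |h idx| := by
  set G := (neuronConst S M r (L - 1) + M) * B ^ (L - 1) * α * γ
  have key : ∀ i : Fin n, ∃ D : EuclideanSpace ℝ (Idx Kn L r d) →L[ℝ] ℝ,
      HasFDerivAt (fun u => (netF σ Kn L r d u (X i) - Y i) ^ 2 * cubeInd d α (X i)) D w ∧
      ∀ h, |D h| ≤ 2 * (|netF σ Kn L r d w (X i) - Y i| * cubeInd d α (X i)) *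
        (G * ∑ idx, |h idx|) := by
    intro i
    by_cases hx : ∀ j, |X i j| ≤ α
    · obtain ⟨D, hD, hDle⟩ :=
        exists_hasFDerivAt_netF hσ hM hS hM1 hB hα hγ w hwγ hw (X i) hx
      simp only [cubeInd_of_mem hx, mul_one]
      refine ⟨_, (hD.sub_const (Y i)).pow 2, fun h => ?_⟩
      simp only [smul_apply, smul_eq_mul, abs_mul]
      simp only [Nat.add_one_sub_one, pow_one, nsmul_eq_mul, Nat.cast_ofNat, abs_mul,
        Nat.abs_ofNat]
      gcongr
      exact hDle h
    · simp only [cubeInd_of_notMem hx, mul_zero, zero_mul]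
      exact ⟨0, hasFDerivAt_const 0 w, fun h => by simp⟩
  choose D hD hDle using key
  refine ⟨_, ((HasFDerivAt.fun_sum (u := Finset.univ) fun i _ => hD i).const_mul
    (1 / (n : ℝ))).add ((HasFDerivAt.fun_sum (u := Finset.univ)
      (A := fun (k : Fin Kn) (u : EuclideanSpace ℝ (Idx Kn L r d)) => u (Sum.inr (Sum.inr k)) ^ 2)
      fun k _ => (hasFDerivAt_coord (Sum.inr (Sum.inr k)) w).pow 2).const_mul c2), fun h => ?_⟩
  simp only [smul_apply, add_apply, sum_apply, smul_eq_mul, PiLp.proj_apply,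
    Nat.add_one_sub_one, pow_one, nsmul_eq_mul, Nat.cast_ofNat]
  have h1 : |1 / (n : ℝ) * ∑ i, D i h| ≤ (1 / (n : ℝ)) * ∑ i,
      2 * (|netF σ Kn L r d w (X i) - Y i| * cubeInd d α (X i)) * (G * ∑ idx, |h idx|) := by
    rw [abs_mul, abs_of_nonneg (by positivity : 0 ≤ 1 / (n : ℝ))]
    gcongr
    exact (Finset.abs_sum_le_sum_abs _ _).trans (Finset.sum_le_sum fun i _ => hDle i h)
  have h2 : |c2 * ∑ k : Fin Kn, 2 * w (Sum.inr (Sum.inr k)) * h (Sum.inr (Sum.inr k))| ≤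
      c2 * (2 * γ * ∑ idx, |h idx|) := by
    rw [abs_mul, abs_of_pos hc2, ← sum_subnetNorm_add, Finset.mul_sum]
    gcongr
    refine (Finset.abs_sum_le_sum_abs _ _).trans (Finset.sum_le_sum fun k _ => ?_)
    rw [abs_mul, abs_mul, abs_two]
    have := subnetNorm_nonneg k h
    have := hwγ k
    gcongr
    linarith
  refine ((abs_add_le _ _).trans (add_le_add h1 h2)).trans_eq ?_
  rw [← Finset.sum_mul, ← Finset.mul_sum]
  ring

lemma mean_abs_residual_le (σ : ℝ → ℝ) {n : ℕ} (X : Fin n → Fin d → ℝ) (Y : Fin n → ℝ)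
    (α : ℝ) {c2 : ℝ} (hc2 : 0 < c2) (v : EuclideanSpace ℝ (Idx Kn L r d)) :
    (1 / (n : ℝ)) * ∑ i, |netF σ Kn L r d v (X i) - Y i| * cubeInd d α (X i) ≤
      √(empRisk σ Kn L r d n X Y α c2 v) := by
  apply Real.le_sqrt_of_sq_le
  have hcs := sq_sum_le_card_mul_sum_sq (s := Finset.univ)
    (f := fun i => |netF σ Kn L r d v (X i) - Y i| * cubeInd d α (X i))
  simp only [mul_pow, sq_abs, sq_cubeInd, Finset.card_univ, Fintype.card_fin] at hcs
  have hreg : 0 ≤ c2 * ∑ k : Fin Kn, v (Sum.inr (Sum.inr k)) ^ 2 := by positivity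
  have hdata : (1 / (n : ℝ)) ^ 2 * (n * ∑ i, (netF σ Kn L r d v (X i) - Y i) ^ 2 *
      cubeInd d α (X i)) = 1 / (n : ℝ) * ∑ i, (netF σ Kn L r d v (X i) - Y i) ^ 2 *
      cubeInd d α (X i) := by
    rcases Nat.eq_zero_or_pos n with rfl | hn
    · simp
    · field_simp
  rw [mul_pow, empRisk]
  have := mul_le_mul_of_nonneg_left hcs (by positivity : 0 ≤ (1 / (n : ℝ)) ^ 2)
  linarith

lemma mean_abs_residual_le_add {σ : ℝ → ℝ} {n : ℕ} (X : Fin n → Fin d → ℝ) (Y : Fin n → ℝ)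
    (α : ℝ) {a : ℝ} (ha : 0 ≤ a) (w v : EuclideanSpace ℝ (Idx Kn L r d))
    (hwv : ∀ x, |netF σ Kn L r d w x - netF σ Kn L r d v x| ≤ a) :
    (1 / (n : ℝ)) * ∑ i, |netF σ Kn L r d w (X i) - Y i| * cubeInd d α (X i) ≤
      (1 / (n : ℝ)) * ∑ i, |netF σ Kn L r d v (X i) - Y i| * cubeInd d α (X i) + a := by
  have hle : ∀ i, |netF σ Kn L r d w (X i) - Y i| * cubeInd d α (X i) ≤
      |netF σ Kn L r d v (X i) - Y i| * cubeInd d α (X i) + a := by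
    intro i
    by_cases hx : ∀ j, |X i j| ≤ α
    · rw [cubeInd_of_mem hx]
      have := abs_sub_le (netF σ Kn L r d w (X i)) (netF σ Kn L r d v (X i)) (Y i)
      linarith [hwv (X i)]
    · simpa [cubeInd_of_notMem hx] using ha
  calc _ ≤ (1 / (n : ℝ)) * ∑ i, (|netF σ Kn L r d v (X i) - Y i| * cubeInd d α (X i) + a) := by
        gcongr with i
        exact hle i
    _ = (1 / (n : ℝ)) * ∑ i, |netF σ Kn L r d v (X i) - Y i| * cubeInd d α (X i) +
          1 / (n : ℝ) * n * a := by
        simp [Finset.sum_add_distrib]; ring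
    _ ≤ _ := by
        gcongr
        refine mul_le_of_le_one_left ha ?_
        rw [one_div]
        exact inv_mul_le_one

end

/-- Lemma 2: bound on the norm of the gradient of the regularized empirical L₂ risk. -/
theorem gradient_norm_bound
    (d r L : ℕ) (hd : 0 < d) (hL : 2 ≤ L) (hr : 2 * d ≤ r)
    (σ : ℝ → ℝ) (hσdiff : Differentiable ℝ σ)
    (hσbdd : ∃ M, ∀ x, |σ x| ≤ M) (hσ'bdd : ∃ M, ∀ x, |deriv σ x| ≤ M)
    (c2 : ℝ) (hc2 : 0 < c2) :
    ∃ c5 : ℝ, 0 < c5 ∧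
      ∀ (n Kn : ℕ) (X : Fin n → Fin d → ℝ) (Y : Fin n → ℝ)
        (αn tn Ln γ B : ℝ) (w v : EuclideanSpace ℝ (Idx Kn L r d)),
        1 ≤ αn → 0 < Ln → Ln ≤ tn → 1 ≤ γ → 1 ≤ B →
        (∀ k : Fin Kn, |w (Sum.inr (Sum.inr k))| ≤ γ) →
        (∀ (k : Fin Kn) (l : Fin (L - 1)) (i : Fin r) (j : Fin (r + 1)),
          |w (Sum.inr (Sum.inl (k, l, i, j)))| ≤ B) →
        (⨆ idx : Idx Kn L r d, |w idx - v idx|) ^ 2 ≤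
            2 * tn / Ln * max (empRisk σ Kn L r d n X Y αn c2 v) 1 →
        ‖gradient (empRisk σ Kn L r d n X Y αn c2) w‖ ≤
          c5 * (Kn : ℝ) ^ (3 / 2 : ℝ) * B ^ (2 * L) * γ ^ 2 * αn ^ 2 *
            Real.sqrt (tn / Ln * max (empRisk σ Kn L r d n X Y αn c2 v) 1) := by
  obtain ⟨M₀, hM₀⟩ := hσbdd
  obtain ⟨S, hS⟩ := hσ'bdd
  set M := max M₀ 1
  have hM : ∀ x, |σ x| ≤ M := fun x => (hM₀ x).trans (le_max_left _ _)
  have hM1 : 1 ≤ M := le_max_right _ _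
  have hC := neuronConst_nonneg ((abs_nonneg _).trans (hS 0)) (zero_le_one.trans hM1) r (L - 1)
  set C := neuronConst S M r (L - 1)
  set q : ℝ := r * (d + 1) + (L - 1 : ℕ) * (r * (r + 1)) + 1 with hq
  have hq0 : 0 < q := by positivity
  refine ⟨√q * (2 * (1 + 4 * M) * (C + M) + 2 * c2), by positivity, ?_⟩
  intro n Kn X Y α t Ln γ B w v hα hLn ht hγ hB hwγ hw hwv
  obtain ⟨D, hD, hDle⟩ :=
    exists_hasFDerivAt_empRisk hσdiff hM hS hM1 hB hα hγ hc2 w hwγ hw X Y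
  have hnorm : ‖gradient (empRisk σ Kn L r d n X Y α c2) w‖ = ‖D‖ := by
    rw [gradient, LinearIsometryEquiv.norm_map, hD.fderiv]
  rw [hnorm]
  set T := t / Ln * max (empRisk σ Kn L r d n X Y α c2 v) 1 with hT
  have htL : 1 ≤ t / Ln := (one_le_div hLn).2 ht
  have hT1 : 1 ≤ T := one_le_mul_of_one_le_of_one_le htL (le_max_right _ _)
  have hFT : empRisk σ Kn L r d n X Y α c2 v ≤ T :=
    (le_max_left _ _).trans (le_mul_of_one_le_left (by positivity) htL)
  have hs1 : 1 ≤ √T := Real.one_le_sqrt.2 hT1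
  have hvγ : ∀ k : Fin Kn, |v (Sum.inr (Sum.inr k))| ≤ 3 * (γ * √T) := by
    intro k
    have h1 := le_ciSup (f := fun idx : Idx Kn L r d => |w idx - v idx|)
      (Set.finite_range _).bddAbove (Sum.inr (Sum.inr k))
    have h2 : (⨆ idx : Idx Kn L r d, |w idx - v idx|) ≤ 2 * √T := by
      refine le_of_abs_le (abs_le_of_sq_le_sq (hwv.trans ?_) (by positivity))
      rw [mul_pow, Real.sq_sqrt (by positivity), mul_div_assoc, mul_assoc, ← hT]
      linarith
    have h3 := abs_sub_abs_le_abs_sub (v (Sum.inr (Sum.inr k))) (w (Sum.inr (Sum.inr k)))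
    rw [abs_sub_comm] at h3
    have h4 : γ ≤ γ * √T := le_mul_of_one_le_right (by positivity) hs1
    have h5 : √T ≤ γ * √T := le_mul_of_one_le_left (by positivity) hγ
    simp only at h1
    linarith [hwγ k]
  have hdiff : ∀ x, |netF σ Kn L r d w x - netF σ Kn L r d v x| ≤
      4 * M * (Kn * (γ * √T)) := by
    intro x
    have h1 := abs_netF_le hM w hwγ x
    have h2 := abs_netF_le hM v hvγ x
    have h3 : Kn * (γ * M) ≤ Kn * (γ * √T * M) := by
      gcongr
      exact le_mul_of_one_le_right (by positivity) hs1
    linarith [abs_sub (netF σ Kn L r d w x) (netF σ Kn L r d v x)]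
  have hres := (mean_abs_residual_le_add X Y α (by positivity) w v hdiff).trans
    (add_le_add_left ((mean_abs_residual_le σ X Y α hc2 v).trans (Real.sqrt_le_sqrt hFT)) _)
  have hcard : (Fintype.card (Idx Kn L r d) : ℝ) = q * Kn := by
    simp only [Fintype.card_sum, Fintype.card_prod, Fintype.card_fin, hq]
    push_cast
    ring
  rcases Nat.eq_zero_or_pos Kn with rfl | hK
  · have : IsEmpty (Idx 0 L r d) := Fintype.card_eq_zero_iff.1 (by
      have : (Fintype.card (Idx 0 L r d) : ℝ) = 0 := by simp
      exact_mod_cast this)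
    have hD0 : D = 0 := by
      ext h
      simp [Subsingleton.elim h 0]
    rw [hD0, norm_zero]
    positivity
  have hK1 : (1 : ℝ) ≤ Kn := by exact_mod_cast hK
  have hres' : (1 / (n : ℝ)) * ∑ i, |netF σ Kn L r d w (X i) - Y i| * cubeInd d α (X i) ≤
      (1 + 4 * M) * (Kn * (γ * √T)) := by
    have : √T ≤ Kn * (γ * √T) := by
      rw [← mul_assoc]
      exact le_mul_of_one_le_left (by positivity) (one_le_mul_of_one_le_of_one_le hK1 hγ)
    linarith
  have hpow : (Kn : ℝ) ^ (3 / 2 : ℝ) = Kn * √Kn := by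
    rw [Real.sqrt_eq_rpow, ← Real.rpow_one_add' (by positivity) (by norm_num)]
    norm_num
  have hBpow : B ^ (L - 1) ≤ B ^ (2 * L) := pow_le_pow_right₀ hB (by omega)
  have hB1 : 1 ≤ B ^ (2 * L) := one_le_pow₀ hB
  have hαsq : α ≤ α ^ 2 := le_self_pow₀ hα two_ne_zero
  refine D.opNorm_le_bound (by positivity) fun h => ?_
  rw [Real.norm_eq_abs]
  calc |D h| ≤ _ := hDle h
    _ ≤ (2 * ((1 + 4 * M) * (Kn * (γ * √T))) * ((C + M) * B ^ (2 * L) * α ^ 2 * γ) +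
          2 * c2 * (γ * (Kn * B ^ (2 * L) * γ * α ^ 2 * √T))) * (√(q * Kn) * ‖h‖) := by
        have hl1 := sum_abs_le_sqrt_card_mul_norm h
        rw [hcard] at hl1
        have hreg : 2 * c2 * γ ≤ 2 * c2 * (γ * (Kn * B ^ (2 * L) * γ * α ^ 2 * √T)) := by
          gcongr
          refine le_mul_of_one_le_right (by positivity) ?_
          refine one_le_mul_of_one_le_of_one_le (one_le_mul_of_one_le_of_one_le
            (one_le_mul_of_one_le_of_one_le (one_le_mul_of_one_le_of_one_le hK1 hB1) hγ)
            (one_le_pow₀ hα)) hs1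
        gcongr
    _ = _ := by
        rw [Real.sqrt_mul hq0.le, hpow]
        ring

end
end

section
/- Let α ≥ 1, β > 0, A, B, C ≥ 1, and let σ : ℝ → ℝ be k-times differentiable such that all derivatives up to order k are bounded on ℝ. Let 𝓕 be the set of all network functions f_w whose weight vector w satisfies Σ_{j=1}^{K_n} |w^{(L)}_{1,1,j}| ≤ C, |w^{(l)}_{k,i,j}| ≤ B for all k ∈ {1,…,K_n}, i,j ∈ {1,…,r}, l ∈ {1,…,L−1}, and |w^{(0)}_{k,i,j}| ≤ A for all k ∈ {1,…,K_n}, i ∈ {1,…,r}, j ∈ {1,…,d}. Then there exist constants c₁₁, c₁₂, c₁₃ > 0 (independent of α, β, A, B, C, ε, n and the x_i) such that for any 1 ≤ p < ∞, any 0 < ε < β and any x₁,…,x_n ∈ ℝ^d, there exists a finite collection of functions f₁,…,f_N : ℝ^d → ℝ with N ≤ (c₁₁·β^p/ε^p)^{c₁₂·α^d·B^{(L−1)·d}·A^d·(C/ε)^{d/k} + c₁₃} such that for every f ∈ 𝓕 there is some i ∈ {1,…,N} with ((1/n)·Σ_{s=1}^n |T_β f(x_s)·1_{[−α,α]^d}(x_s)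 − f_i(x_s)|^p)^{1/p} < ε. -/
open MeasureTheory ProbabilityTheory Filter

noncomputable section

/-- The closed unit ball of `Fin d → ℝ` for the sup norm, i.e. the cube `[-1, 1]^d`. -/
abbrev UnitCube (d : ℕ) : Type := Metric.closedBall (0 : Fin d → ℝ) 1

/-- A coordinate as a continuous function on the unit cube. -/
def cubeCoord (d : ℕ) (j : Fin d) : C(UnitCube d, ℝ) :=
  ⟨fun y => (y : Fin d → ℝ) j, (continuous_apply j).comp continuous_subtype_val⟩

/-- Restrictions to the unit cube of polynomials of total degree at most `D`. -/
def polyCube (d D : ℕ) : Submodule ℝ C(UnitCube d, ℝ) :=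
  Submodule.span ℝ (insert 1 (Set.range (cubeCoord d))) ^ D

lemma one_le_span_cubeCoord (d : ℕ) :
    (1 : Submodule ℝ C(UnitCube d, ℝ)) ≤
      Submodule.span ℝ (insert 1 (Set.range (cubeCoord d))) :=
  Submodule.one_le.2 (Submodule.subset_span (Set.mem_insert _ _))

lemma polyCube_mono (d : ℕ) {D D' : ℕ} (h : D ≤ D') : polyCube d D ≤ polyCube d D' :=
  pow_le_pow_right' (one_le_span_cubeCoord d) h

lemma const_mem_polyCube (d D : ℕ) (c : ℝ) :
    ContinuousMap.const (UnitCube d) c ∈ polyCube d D := by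
  have h1 : (1 : C(UnitCube d, ℝ)) ∈ polyCube d D :=
    Submodule.one_le.1 (one_le_pow_of_one_le' (one_le_span_cubeCoord d) D)
  convert (polyCube d D).smul_mem c h1 using 1
  ext y
  simp

lemma cubeCoord_mem_polyCube (d : ℕ) (j : Fin d) : cubeCoord d j ∈ polyCube d 1 := by
  rw [polyCube, pow_one]
  exact Submodule.subset_span (Set.mem_insert_of_mem _ ⟨j, rfl⟩)

lemma pow_mem_polyCube {d D : ℕ} {P : C(UnitCube d, ℝ)} (hP : P ∈ polyCube d D) (i : ℕ) :
    P ^ i ∈ polyCube d (D * i) := by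
  rw [polyCube, pow_mul]
  exact Submodule.pow_mem_pow _ hP i


lemma polyCube_finite (d D : ℕ) : FiniteDimensional ℝ (polyCube d D) := by
  have h : (Submodule.span ℝ (insert 1 (Set.range (cubeCoord d)))).FG :=
    Submodule.fg_span ((Set.finite_range _).insert _)
  exact Module.Finite.iff_fg.2 (h.pow D)

/-- Finitely many labels distinguish bounded polynomials on the unit cube up to precision `e`. -/
lemma exists_label_polyCube (d D : ℕ) (κ : ℝ) {e : ℝ} (he : 0 < e) :
    ∃ (T : ℕ) (lab : C(UnitCube d, ℝ) → Fin T), ∀ P ∈ polyCube d D, ∀ P' ∈ polyCube d D,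
      (∀ y, |P y| ≤ κ) → (∀ y, |P' y| ≤ κ) → lab P = lab P' → ∀ y, |P y - P' y| ≤ e := by
  have := polyCube_finite d D
  have : ProperSpace (polyCube d D) := FiniteDimensional.proper ℝ _
  have : Nonempty (UnitCube d) := ⟨⟨0, by simp⟩⟩
  obtain ⟨t, -, htf, ht⟩ :=
    (isCompact_closedBall (0 : polyCube d D) κ).finite_cover_balls (half_pos he)
  have key : ∀ P : C(UnitCube d, ℝ), ∃ q : Option t, (h : P ∈ polyCube d D) → (∀ y, |P y| ≤ κ) →
      ∃ q' : t, q = some q' ∧ dist P ((q' : polyCube d D) : C(UnitCube d, ℝ)) < e / 2 := by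
    intro P
    by_cases h : P ∈ polyCube d D ∧ ∀ y, |P y| ≤ κ
    · have hb : (⟨P, h.1⟩ : polyCube d D) ∈ Metric.closedBall 0 κ := by
        rw [mem_closedBall_zero_iff]
        exact (ContinuousMap.norm_le_of_nonempty P).2 h.2
      obtain ⟨q, hq, hPq⟩ := Set.mem_iUnion₂.1 (ht hb)
      exact ⟨some ⟨q, hq⟩, fun _ _ => ⟨⟨q, hq⟩, rfl, hPq⟩⟩
    · exact ⟨none, fun h1 h2 => (h ⟨h1, h2⟩).elim⟩
  choose q hq using key
  have : Fintype t := htf.fintype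
  refine ⟨_, fun P => Fintype.equivFin _ (q P), fun P hP P' hP' hb hb' hl y => ?_⟩
  obtain ⟨a, ha, hda⟩ := hq P hP hb
  obtain ⟨a', ha', hda'⟩ := hq P' hP' hb'
  have : a = a' := by
    have := (Fintype.equivFin _).injective hl
    rw [ha, ha'] at this
    exact Option.some_injective _ this
  subst this
  have h1 := ContinuousMap.dist_apply_le_dist (f := P) (g := P') y
  rw [Real.dist_eq] at h1
  have h2 := dist_triangle_right P P' ((a : polyCube d D) : C(UnitCube d, ℝ))
  linarith

lemma exists_taylor_bound {k : ℕ} (hk : 0 < k) {σ : ℝ → ℝ} (hσ : ContDiff ℝ k σ)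
    (hσbdd : ∀ i ≤ k, ∃ M, ∀ x, |iteratedDeriv i σ x| ≤ M) :
    ∃ M : ℝ, 0 ≤ M ∧ (∀ t, |σ t| ≤ M) ∧ (∀ s t, |σ s - σ t| ≤ M * |s - t|) ∧
      ∀ t, ∃ c : ℕ → ℝ, (∀ i < k, |c i| ≤ M) ∧
        ∀ s, |σ (t + s) - ∑ i ∈ Finset.range k, c i * s ^ i| ≤ M * |s| ^ k := by
  have hM' : ∃ M : ℝ, ∀ i ≤ k, ∀ x, |iteratedDeriv i σ x| ≤ M := by
    choose! M hM using hσbdd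
    refine ⟨∑ i ∈ Finset.range (k + 1), |M i|, fun i hi x => (hM i hi x).trans ?_⟩
    exact (le_abs_self _).trans (Finset.single_le_sum (f := fun i => |M i|)
      (fun _ _ => abs_nonneg _) (Finset.mem_range.2 (Nat.lt_succ_of_le hi)))
  obtain ⟨M, hM⟩ := hM'
  have hM0 : 0 ≤ M := (abs_nonneg _).trans (hM 0 (Nat.zero_le _) 0)
  refine ⟨M, hM0, fun t => by simpa using hM 0 (Nat.zero_le _) t, fun s t => ?_, fun t => ?_⟩
  · have hd : Differentiable ℝ σ := hσ.differentiable (by exact_mod_cast hk.ne')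
    have := Convex.norm_image_sub_le_of_norm_deriv_le (f := σ) (C := M) (s := Set.univ)
      (x := t) (y := s) (fun x _ => hd x) (fun x _ => ?_) convex_univ trivial trivial
    · simpa using this
    · simpa using hM 1 hk x
  · refine ⟨fun i => iteratedDeriv i σ t / i.factorial, fun i hi => ?_, fun s => ?_⟩
    · have h1 : (1 : ℝ) ≤ (i.factorial : ℝ) := by exact_mod_cast i.factorial_pos
      rw [abs_div, Nat.abs_cast]
      exact (div_le_self (abs_nonneg _) h1).trans (hM i hi.le t)
    · obtain ⟨n, rfl⟩ : ∃ n, k = n + 1 := ⟨k - 1, by omega⟩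
      rcases eq_or_ne s 0 with rfl | hs
      · rw [Finset.sum_eq_single 0]
        · simp
        · intro i _ hi
          simp [hi]
        · simp
      have hne : t ≠ t + s := by simpa using hs
      obtain ⟨x', -, hx'⟩ := taylor_mean_remainder_lagrange_iteratedDeriv (f := σ) (n := n) hne
        (by exact_mod_cast hσ.contDiffOn)
      have hT : taylorWithinEval σ n (Set.uIcc t (t + s)) t (t + s) =
          ∑ i ∈ Finset.range (n + 1), iteratedDeriv i σ t / i.factorial * s ^ i := by
        rw [taylor_within_apply]
        refine Finset.sum_congr rfl fun i hi => ?_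
        rw [iteratedDerivWithin_eq_iteratedDeriv (uniqueDiffOn_uIcc hne)
          ((hσ.of_le ?_).contDiffAt) Set.left_mem_uIcc]
        · simp only [add_sub_cancel_left, smul_eq_mul]
          ring
        · exact_mod_cast (Finset.mem_range.1 hi).le
      rw [← hT, hx', add_sub_cancel_left, abs_div, abs_mul, abs_pow, Nat.abs_cast]
      have h1 : (1 : ℝ) ≤ ((n + 1).factorial : ℝ) := by exact_mod_cast (n + 1).factorial_pos
      exact (div_le_self (by positivity) h1).trans
        (mul_le_mul_of_nonneg_right (hM (n + 1) le_rfl x') (by positivity))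

/-- Composition with a smooth activation function: a function `u` of size `O(τ)` which is
polynomial up to `O(τ ^ k)` is mapped to a function with the same properties. -/
lemma exists_activation_bound {k : ℕ} (hk : 0 < k) {σ : ℝ → ℝ} (hσ : ContDiff ℝ k σ)
    (hσbdd : ∀ i ≤ k, ∃ M, ∀ x, |iteratedDeriv i σ x| ≤ M) (d D : ℕ) {K : ℝ} (hK : 0 ≤ K) :
    ∃ (M : ℝ) (D' : ℕ), 0 ≤ M ∧ ∀ (u : UnitCube d → ℝ) (t τ : ℝ) (P : C(UnitCube d, ℝ)),
      P ∈ polyCube d D → 0 ≤ τ → τ ≤ 1 → (∀ y, |u y| ≤ K * τ) →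
      (∀ y, |u y - P y| ≤ K * τ ^ k) →
      (∀ y, |σ (t + u y) - σ t| ≤ M * τ) ∧
        ∃ Q ∈ polyCube d D', ∀ y, |σ (t + u y) - Q y| ≤ M * τ ^ k := by
  obtain ⟨M, hM0, -, hLip, hT⟩ := exists_taylor_bound hk hσ hσbdd
  set S : ℝ := ∑ i ∈ Finset.range k, M * (i * (2 * K) ^ (i - 1) * K) with hS
  have hS0 : 0 ≤ S := Finset.sum_nonneg fun i _ => by positivity
  refine ⟨M * K + M * K ^ k + S, D * k, by positivity,
    fun u t τ P hP hτ0 hτ1 hu hP' => ⟨fun y => ?_, ?_⟩⟩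
  · calc |σ (t + u y) - σ t| ≤ M * |t + u y - t| := hLip _ _
      _ ≤ M * (K * τ) := by
        rw [add_sub_cancel_left]
        exact mul_le_mul_of_nonneg_left (hu y) hM0
      _ = M * K * τ := by ring
      _ ≤ (M * K + M * K ^ k + S) * τ := by
        apply mul_le_mul_of_nonneg_right _ hτ0
        have : 0 ≤ M * K ^ k := by positivity
        linarith
  · obtain ⟨c, hc, hcT⟩ := hT t
    refine ⟨∑ i ∈ Finset.range k, c i • P ^ i, Submodule.sum_mem _ fun i hi =>
      Submodule.smul_mem _ _ (polyCube_mono d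
        (Nat.mul_le_mul_left D (Finset.mem_range.1 hi).le) (pow_mem_polyCube hP i)), fun y => ?_⟩
    have hτk : τ ^ k ≤ τ := by simpa using pow_le_pow_of_le_one hτ0 hτ1 hk
    have hu2 : |u y| ≤ 2 * K := by nlinarith [hu y]
    have hP2 : |P y| ≤ 2 * K := by
      have h1 : |P y| ≤ |u y| + |u y - P y| := by
        have := abs_sub_abs_le_abs_sub (P y) (u y)
        rw [abs_sub_comm] at this
        linarith
      nlinarith [hu y, hP' y]
    have hpow : ∀ i : ℕ, |u y ^ i - P y ^ i| ≤ i * (2 * K) ^ (i - 1) * K * τ ^ k := fun i => by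
      calc |u y ^ i - P y ^ i| ≤ |u y - P y| * i * max |u y| |P y| ^ (i - 1) :=
            abs_pow_sub_pow_le ..
        _ ≤ K * τ ^ k * i * (2 * K) ^ (i - 1) := by
            gcongr
            · exact hP' y
            · exact max_le hu2 hP2
        _ = _ := by ring
    have hsum : |∑ i ∈ Finset.range k, c i * u y ^ i - ∑ i ∈ Finset.range k, c i * P y ^ i| ≤
        S * τ ^ k := by
      rw [← Finset.sum_sub_distrib, hS, Finset.sum_mul]
      refine (Finset.abs_sum_le_sum_abs _ _).trans (Finset.sum_le_sum fun i hi => ?_)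
      rw [← mul_sub, abs_mul, mul_assoc M]
      exact mul_le_mul (hc i (Finset.mem_range.1 hi)) (hpow i) (abs_nonneg _) hM0
    have hrem : |σ (t + u y) - ∑ i ∈ Finset.range k, c i * u y ^ i| ≤ M * K ^ k * τ ^ k := by
      refine (hcT (u y)).trans ?_
      rw [mul_assoc, ← mul_pow]
      gcongr
      exact hu y
    have hval : (∑ i ∈ Finset.range k, c i • P ^ i : C(UnitCube d, ℝ)) y =
        ∑ i ∈ Finset.range k, c i * P y ^ i := by
      simp
    rw [hval]
    have htri := abs_sub_le (σ (t + u y)) (∑ i ∈ Finset.range k, c i * u y ^ i)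
      (∑ i ∈ Finset.range k, c i * P y ^ i)
    have h0 : 0 ≤ M * K * τ ^ k := by positivity
    linarith

lemma abs_sum_mul_le {ι : Type*} [Fintype ι] {a b : ι → ℝ} {A B : ℝ} (hA : ∑ i, |a i| ≤ A)
    (hB0 : 0 ≤ B) (hB : ∀ i, |b i| ≤ B) : |∑ i, a i * b i| ≤ A * B := by
  calc |∑ i, a i * b i| ≤ ∑ i, |a i * b i| := Finset.abs_sum_le_sum_abs _ _
    _ ≤ ∑ i, |a i| * B := Finset.sum_le_sum fun i _ => by
      rw [abs_mul]
      exact mul_le_mul_of_nonneg_left (hB i) (abs_nonneg _)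
    _ = (∑ i, |a i|) * B := by rw [Finset.sum_mul]
    _ ≤ A * B := mul_le_mul_of_nonneg_right hA hB0

lemma sum_abs_le_card_mul {n : ℕ} {a : Fin n → ℝ} {A : ℝ} (h : ∀ i, |a i| ≤ A) :
    ∑ i, |a i| ≤ n * A := by
  simpa using Finset.sum_le_card_nsmul Finset.univ (fun i => |a i|) A fun i _ => h i

/-- On a cube of side `ρ ≤ (A * B ^ m)⁻¹` a neuron of layer `m + 1` is Lipschitz and polynomial
up to an error of order `(A * B ^ m * ρ) ^ k`. -/
lemma exists_hid_bound {k : ℕ} (hk : 0 < k) {σ : ℝ → ℝ} (hσ : ContDiff ℝ k σ)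
    (hσbdd : ∀ i ≤ k, ∃ M, ∀ x, |iteratedDeriv i σ x| ≤ M) (L r d m : ℕ) :
    ∃ (M : ℝ) (D : ℕ), 0 ≤ M ∧ ∀ (Kn : ℕ) (w : EuclideanSpace ℝ (Idx Kn L r d)) (A B : ℝ),
      1 ≤ A → 1 ≤ B →
      (∀ (k' : Fin Kn) (l : Fin (L - 1)) (i : Fin r) (j : Fin r),
        |w (Sum.inr (Sum.inl (k', l, i, j.succ)))| ≤ B) →
      (∀ (k' : Fin Kn) (i : Fin r) (j : Fin d), |w (Sum.inl (k', i, j.succ))| ≤ A) →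
      ∀ (k' : Fin Kn) (i : Fin r) (x₀ : Fin d → ℝ) (ρ : ℝ), 0 ≤ ρ → A * B ^ m * ρ ≤ 1 →
        (∀ y : UnitCube d, |hid σ Kn L r d w k' m i (x₀ + ρ • (y : Fin d → ℝ)) -
          hid σ Kn L r d w k' m i x₀| ≤ M * (A * B ^ m * ρ)) ∧
        ∃ P ∈ polyCube d D, ∀ y : UnitCube d,
          |hid σ Kn L r d w k' m i (x₀ + ρ • (y : Fin d → ℝ)) - P y| ≤
            M * (A * B ^ m * ρ) ^ k := by
  induction m with
  | zero =>
    obtain ⟨M, D', hM, h⟩ :=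
      exists_activation_bound hk hσ hσbdd d 1 (K := (d : ℝ)) (Nat.cast_nonneg d)
    refine ⟨M, D', hM, fun Kn w A B hA hB _ hw k' i x₀ ρ hρ hρ1 => ?_⟩
    simp only [pow_zero, mul_one] at hρ1 ⊢
    set P : C(UnitCube d, ℝ) := ∑ j, (w (Sum.inl (k', i, j.succ)) * ρ) • cubeCoord d j with hPdef
    have hPval : ∀ y, P y = ∑ j, (w (Sum.inl (k', i, j.succ)) * ρ) * (y : Fin d → ℝ) j := by
      intro y
      simp [hPdef, cubeCoord]
    have hP : P ∈ polyCube d 1 := Submodule.sum_mem _ fun j _ =>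
      Submodule.smul_mem _ _ (cubeCoord_mem_polyCube d j)
    have hτ : 0 ≤ A * ρ := by positivity
    have hPb : ∀ y, |P y| ≤ d * (A * ρ) := fun y => by
      rw [hPval]
      have := abs_sum_mul_le (a := fun j => w (Sum.inl (k', i, j.succ)) * ρ)
        (b := (y : Fin d → ℝ)) (B := 1) (sum_abs_le_card_mul (A := A * ρ) fun j => ?_) zero_le_one
        fun j => ?_
      · simpa using this
      · rw [abs_mul, abs_of_nonneg hρ]
        exact mul_le_mul_of_nonneg_right (hw k' i j) hρ
      · exact (norm_le_pi_norm (y : Fin d → ℝ) j).trans (mem_closedBall_zero_iff.1 y.2)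
    have := h (fun y => P y)
      ((∑ j, w (Sum.inl (k', i, j.succ)) * x₀ j) + w (Sum.inl (k', i, 0))) (A * ρ) P hP hτ hρ1
      hPb (fun y => by simp only [sub_self, abs_zero]; positivity)
    have hhid : ∀ y : UnitCube d, hid σ Kn L r d w k' 0 i (x₀ + ρ • (y : Fin d → ℝ)) =
        σ ((∑ j, w (Sum.inl (k', i, j.succ)) * x₀ j) + w (Sum.inl (k', i, 0)) + P y) := by
      intro y
      rw [hid, hPval]
      simp only [Pi.add_apply, Pi.smul_apply, smul_eq_mul, mul_add, Finset.sum_add_distrib,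
        mul_assoc]
      congr 1
      ring
    simp only [hhid]
    exact this
  | succ m ih =>
    obtain ⟨M₀, D, hM₀, ih⟩ := ih
    obtain ⟨M, D', hM, h⟩ :=
      exists_activation_bound hk hσ hσbdd d D (K := r * M₀) (by positivity)
    refine ⟨M, D', hM, fun Kn w A B hA hB hw' hw k' i x₀ ρ hρ hρ1 => ?_⟩
    have hB0 : 0 ≤ B := zero_le_one.trans hB
    set Λ : ℝ := A * B ^ m with hΛ
    have hΛ0 : 0 ≤ Λ := by positivity
    have hΛB : A * B ^ (m + 1) * ρ = B * (Λ * ρ) := by rw [hΛ]; ring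
    rw [hΛB] at hρ1 ⊢
    have hΛρ : Λ * ρ ≤ 1 := (le_mul_of_one_le_left (by positivity) hB).trans hρ1
    have ih := fun j => ih Kn w A B hA hB hw' hw k' j x₀ ρ hρ hΛρ
    simp only [← hΛ] at ih
    choose ihL Pj hPj ihP using ih
    set W : Fin r → ℝ := fun j =>
      if h : m < L - 1 then w (Sum.inr (Sum.inl (k', ⟨m, h⟩, i, j.succ))) else 0 with hW
    have hWB : ∀ j, |W j| ≤ B := fun j => by
      simp only [hW]
      split_ifs
      · exact hw' _ _ _ _
      · simpa using hB0
    set b : ℝ := if h : m < L - 1 then w (Sum.inr (Sum.inl (k', ⟨m, h⟩, i, 0))) else 0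
    set H : Fin r → (Fin d → ℝ) → ℝ := hid σ Kn L r d w k' m with hH
    set P : C(UnitCube d, ℝ) := ∑ j, W j • (Pj j - ContinuousMap.const _ (H j x₀)) with hPdef
    have hP : P ∈ polyCube d D := Submodule.sum_mem _ fun j _ =>
      Submodule.smul_mem _ _ (Submodule.sub_mem _ (hPj j) (const_mem_polyCube d D _))
    have hPval : ∀ y, P y = ∑ j, W j * (Pj j y - H j x₀) := fun y => by simp [hPdef]
    have := h (fun y => ∑ j, W j * (H j (x₀ + ρ • (y : Fin d → ℝ)) - H j x₀))
      ((∑ j, W j * H j x₀) + b) (B * (Λ * ρ)) P hP (by positivity) hρ1 (fun y => ?_) fun y => ?_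
    · have hhid : ∀ x, hid σ Kn L r d w k' (m + 1) i x = σ ((∑ j, W j * H j x) + b) :=
        fun x => rfl
      have hadd : ∀ y : UnitCube d, (∑ j, W j * H j x₀) + b +
          ∑ j, W j * (H j (x₀ + ρ • (y : Fin d → ℝ)) - H j x₀) =
            (∑ j, W j * H j (x₀ + ρ • (y : Fin d → ℝ))) + b := fun y => by
        simp only [mul_sub, Finset.sum_sub_distrib]
        ring
      simp only [hhid]
      simpa only [hadd] using this
    · refine (abs_sum_mul_le (sum_abs_le_card_mul hWB) (by positivity) fun j => ihL j y).trans
        (le_of_eq ?_)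
      ring
    · rw [hPval, ← Finset.sum_sub_distrib]
      simp only [← mul_sub, sub_sub_sub_cancel_right]
      refine (abs_sum_mul_le (sum_abs_le_card_mul hWB) (by positivity) fun j => ihP j y).trans ?_
      have hBk : B ≤ B ^ k := le_self_pow₀ hB hk.ne'
      calc r * B * (M₀ * (Λ * ρ) ^ k) = B * (r * M₀ * (Λ * ρ) ^ k) := by ring
        _ ≤ B ^ k * (r * M₀ * (Λ * ρ) ^ k) := by gcongr
        _ = r * M₀ * (B * (Λ * ρ)) ^ k := by ring

/-- The networks are bounded by a multiple of `C`, and on a cube of side `ρ` they are polynomial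
up to an error of order `C * (A * B ^ (L - 1) * ρ) ^ k`. -/
lemma exists_netF_bound {k : ℕ} (hk : 0 < k) {σ : ℝ → ℝ} (hσ : ContDiff ℝ k σ)
    (hσbdd : ∀ i ≤ k, ∃ M, ∀ x, |iteratedDeriv i σ x| ≤ M) (L r d : ℕ) :
    ∃ (M : ℝ) (D : ℕ), 1 ≤ M ∧ ∀ (Kn : ℕ) (w : EuclideanSpace ℝ (Idx Kn L r d)) (A B C : ℝ),
      1 ≤ A → 1 ≤ B → (∑ j : Fin Kn, |w (Sum.inr (Sum.inr j))|) ≤ C →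
      (∀ (k' : Fin Kn) (l : Fin (L - 1)) (i : Fin r) (j : Fin r),
        |w (Sum.inr (Sum.inl (k', l, i, j.succ)))| ≤ B) →
      (∀ (k' : Fin Kn) (i : Fin r) (j : Fin d), |w (Sum.inl (k', i, j.succ))| ≤ A) →
      (∀ x, |netF σ Kn L r d w x| ≤ C * M) ∧
      ∀ (x₀ : Fin d → ℝ) (ρ : ℝ), 0 ≤ ρ → A * B ^ (L - 1) * ρ ≤ 1 →
        ∃ P ∈ polyCube d D, ∀ y : UnitCube d,
          |netF σ Kn L r d w (x₀ + ρ • (y : Fin d → ℝ)) - P y| ≤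
            C * M * (A * B ^ (L - 1) * ρ) ^ k := by
  obtain ⟨M₀, hM₀, hb, -, -⟩ := exists_taylor_bound hk hσ hσbdd
  obtain ⟨M, D, hM, h⟩ := exists_hid_bound hk hσ hσbdd L r d (L - 1)
  have hhid : ∀ (Kn : ℕ) (w : EuclideanSpace ℝ (Idx Kn L r d)) (k' : Fin Kn) (m : ℕ) (i : Fin r)
      (x : Fin d → ℝ), |hid σ Kn L r d w k' m i x| ≤ M₀ := by
    intro Kn w k' m i x
    cases m <;> exact hb _
  refine ⟨M₀ + M + 1, D, by linarith, fun Kn w A B C hA hB hC hw' hw => ⟨fun x => ?_,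
    fun x₀ ρ hρ hρ1 => ?_⟩⟩
  · refine abs_sum_mul_le hC (by positivity) fun j => ?_
    rw [subnet]
    split_ifs
    · exact (hhid ..).trans (by linarith)
    · simpa using (by positivity : 0 ≤ M₀ + M + 1)
  · have hsub : ∀ k', ∃ P ∈ polyCube d D, ∀ y : UnitCube d,
        |subnet σ Kn L r d w k' (x₀ + ρ • (y : Fin d → ℝ)) - P y| ≤
          (M₀ + M + 1) * (A * B ^ (L - 1) * ρ) ^ k := by
      intro k'
      by_cases hr : 0 < r
      · obtain ⟨P, hP, hPb⟩ := (h Kn w A B hA hB hw' hw k' ⟨0, hr⟩ x₀ ρ hρ hρ1).2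
        refine ⟨P, hP, fun y => ?_⟩
        rw [subnet, dif_pos hr]
        refine (hPb y).trans ?_
        gcongr
        linarith
      · refine ⟨0, Submodule.zero_mem _, fun y => ?_⟩
        rw [subnet, dif_neg hr]
        simp only [ContinuousMap.zero_apply, sub_self, abs_zero]
        positivity
    choose P hP hPb using hsub
    refine ⟨∑ j, w (Sum.inr (Sum.inr j)) • P j,
      Submodule.sum_mem _ fun j _ => Submodule.smul_mem _ _ (hP j), fun y => ?_⟩
    have hval : (∑ j, w (Sum.inr (Sum.inr j)) • P j : C(UnitCube d, ℝ)) y =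
        ∑ j, w (Sum.inr (Sum.inr j)) * P j y := by simp
    rw [hval, netF, ← Finset.sum_sub_distrib]
    simp only [← mul_sub]
    rw [mul_assoc]
    exact abs_sum_mul_le hC (by positivity) fun j => hPb j y

/-- One refinement step: a labelling of a class of functions with accuracy `R` on `Q` is refined
to one with accuracy `8 * b`, if the functions are `b`-close to polynomials on finitely many
cubes which cover `Q`. -/
lemma exists_label_refine {W ι : Type*} [Nonempty W] [Fintype ι] {d D T N : ℕ}
    {val : W → (Fin d → ℝ) → ℝ} {Q : Set (Fin d → ℝ)} {c : ι → Fin d → ℝ} {ρ b κ R : ℝ}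
    (hb : 0 < b) (hR : R ≤ (κ - 2) * b)
    (hcov : ∀ x ∈ Q, ∃ i, ∃ y : UnitCube d, x = c i + ρ • (y : Fin d → ℝ))
    (hQ : ∀ i, ∀ y : UnitCube d, c i + ρ • (y : Fin d → ℝ) ∈ Q)
    (hpoly : ∀ f i, ∃ P ∈ polyCube d D, ∀ y : UnitCube d,
      |val f (c i + ρ • (y : Fin d → ℝ)) - P y| ≤ b)
    {plab : C(UnitCube d, ℝ) → Fin T}
    (hplab : ∀ P ∈ polyCube d D, ∀ P' ∈ polyCube d D,
      (∀ y, |P y| ≤ κ) → (∀ y, |P' y| ≤ κ) → plab P = plab P' → ∀ y, |P y - P' y| ≤ 4)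
    {lab : W → Fin N}
    (hlab : ∀ f g, lab f = lab g → ∀ x ∈ Q, |val f x - val g x| ≤ R) :
    ∃ lab' : W → Fin (N * T ^ Fintype.card ι),
      ∀ f g, lab' f = lab' g → ∀ x ∈ Q, |val f x - val g x| ≤ 8 * b := by
  classical
  choose P hP hPb using hpoly
  set rep : W → W := fun f => Function.invFun lab (lab f) with hrep
  have hrep_lab : ∀ f, lab f = lab (rep f) := fun f =>
    (Function.invFun_eq (f := lab) (b := lab f) ⟨f, rfl⟩).symm
  set q : W → ι → C(UnitCube d, ℝ) := fun f i => b⁻¹ • (P f i - P (rep f) i) with hq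
  have hqmem : ∀ f i, q f i ∈ polyCube d D := fun f i =>
    Submodule.smul_mem _ _ (Submodule.sub_mem _ (hP f i) (hP _ i))
  have hqval : ∀ f i y, b * q f i y = P f i y - P (rep f) i y := fun f i y => by
    simp [hq, hb.ne']
  have hqκ : ∀ f i y, |q f i y| ≤ κ := fun f i y => by
    have h1 := hlab f (rep f) (hrep_lab f) _ (hQ i y)
    have h2 := hPb f i y
    have h3 := hPb (rep f) i y
    have h4 : |b * q f i y| ≤ κ * b := by
      rw [hqval]
      rw [abs_le] at *
      constructor <;> linarith
    rw [abs_mul, abs_of_pos hb, mul_comm] at h4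
    exact le_of_mul_le_mul_right h4 hb
  let e : (Fin N × (ι → Fin T)) ≃ Fin (N * T ^ Fintype.card ι) :=
    Fintype.equivFinOfCardEq (by simp)
  refine ⟨fun f => e (lab f, fun i => plab (q f i)), fun f g hfg x hx => ?_⟩
  obtain ⟨hl, hp⟩ := Prod.ext_iff.1 (e.injective hfg)
  obtain ⟨i, y, rfl⟩ := hcov x hx
  have hfg_rep : rep f = rep g := congrArg (Function.invFun lab) hl
  have h1 := hplab _ (hqmem f i) _ (hqmem g i) (hqκ f i) (hqκ g i) (congrFun hp i) y
  have h2 : |b * q f i y - b * q g i y| ≤ 4 * b := by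
    rw [← mul_sub, abs_mul, abs_of_pos hb, mul_comm]
    exact mul_le_mul_of_nonneg_right h1 hb.le
  rw [hqval, hqval, hfg_rep] at h2
  have h3 := hPb f i y
  have h4 := hPb g i y
  rw [abs_le] at *
  constructor <;> linarith

/-- A point of `[-α, α]` lies in one of the `m` intervals of length `2 * α / m`. -/
lemma exists_grid_center {α : ℝ} (hα : 0 < α) {m : ℕ} (hm : 0 < m) {x : ℝ} (hx : |x| ≤ α) :
    ∃ i : Fin m, |x - (-α + (2 * (i : ℕ) + 1) * (α / m))| ≤ α / m := by
  have hm' : (0 : ℝ) < m := by exact_mod_cast hm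
  set ρ := α / m with hρ
  have hρ0 : 0 < ρ := by positivity
  have hmρ : m * ρ = α := by rw [hρ]; field_simp
  obtain ⟨h1, h2⟩ := abs_le.1 hx
  rcases h2.eq_or_lt with rfl | h2
  · refine ⟨⟨m - 1, by omega⟩, ?_⟩
    have : ((m - 1 : ℕ) : ℝ) = m - 1 := by simp [Nat.cast_sub (Nat.one_le_iff_ne_zero.2 hm.ne')]
    simp only [this]
    rw [abs_le]
    constructor <;> nlinarith
  · set z := (x + α) / (2 * ρ) with hz
    have hz0 : 0 ≤ z := div_nonneg (by linarith) (by positivity)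
    have hzx : z * (2 * ρ) = x + α := by rw [hz]; field_simp
    have hzm : z < m := by
      rw [hz, div_lt_iff₀ (by positivity)]
      linarith
    refine ⟨⟨⌊z⌋₊, (Nat.floor_lt hz0).2 hzm⟩, ?_⟩
    have h3 := Nat.floor_le hz0
    have h4 := Nat.lt_floor_add_one z
    simp only
    rw [abs_le]
    constructor <;> nlinarith

/-- Kolmogorov–Tikhomirov type bound: a uniformly bounded class of functions, which are
polynomial up to an error `a * (Λ * ρ) ^ k` on cubes of side `ρ`, is divided into at most
`T ^ (2 * (m * 2 ^ J) ^ d)` parts of diameter at most `8 * a / 2 ^ (J * k)` on `[-α, α]^d`. -/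
lemma exists_label_bound {d : ℕ} (hd : 0 < d) (D k : ℕ) :
    ∃ T : ℕ, 1 ≤ T ∧ ∀ (W : Type) [Nonempty W] (val : W → (Fin d → ℝ) → ℝ) (a Λ α : ℝ) (m : ℕ),
      0 < a → 0 < α → 0 < m → 0 ≤ Λ → α * Λ ≤ m → (∀ f x, |val f x| ≤ a) →
      (∀ (f : W) (x₀ : Fin d → ℝ) (ρ : ℝ), 0 ≤ ρ → Λ * ρ ≤ 1 → ∃ P ∈ polyCube d D,
        ∀ y : UnitCube d, |val f (x₀ + ρ • (y : Fin d → ℝ)) - P y| ≤ a * (Λ * ρ) ^ k) →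
      ∀ J : ℕ, ∃ (N : ℕ) (lab : W → Fin N), N ≤ T ^ (2 * (m * 2 ^ J) ^ d) ∧
        ∀ f g, lab f = lab g → ∀ x : Fin d → ℝ, (∀ j, |x j| ≤ α) →
          |val f x - val g x| ≤ 8 * (a / (2 ^ J) ^ k) := by
  obtain ⟨T, plab, hplab⟩ := exists_label_polyCube d D (8 * 2 ^ k + 2) (e := 4) (by norm_num)
  have hT : 1 ≤ T := (plab 0).pos
  refine ⟨T, hT, fun W _ val a Λ α m ha hα hm hΛ hαΛ hbd hpoly J => ?_⟩
  induction J with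
  | zero =>
    refine ⟨1, fun _ => 0, Nat.one_le_pow _ _ hT, fun f g _ x _ => ?_⟩
    have h1 := hbd f x
    have h2 := hbd g x
    simp only [pow_zero, one_pow, div_one]
    rw [abs_le] at *
    constructor <;> linarith
  | succ J ih =>
    obtain ⟨N, lab, hN, hlab⟩ := ih
    set M : ℕ := m * 2 ^ (J + 1) with hM
    have hM0 : 0 < M := by positivity
    have hM0' : (0 : ℝ) < M := by exact_mod_cast hM0
    set ρ : ℝ := α / M with hρ
    have hρ0 : 0 < ρ := by positivity
    have hMρ : M * ρ = α := by rw [hρ]; field_simp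
    have hΛρ : Λ * ρ ≤ 1 / 2 ^ (J + 1) := by
      rw [hρ, ← mul_div_assoc, div_le_div_iff₀ hM0' (by positivity), hM]
      push_cast
      rw [one_mul, mul_comm Λ]
      gcongr
    have hΛρ1 : Λ * ρ ≤ 1 := hΛρ.trans (by
      rw [div_le_one (by positivity)]
      exact one_le_pow₀ one_le_two)
    set b : ℝ := a / (2 ^ (J + 1)) ^ k with hbdef
    have hb : 0 < b := by positivity
    have hbρ : a * (Λ * ρ) ^ k ≤ b := by
      rw [hbdef, div_eq_mul_one_div, ← one_div_pow]
      gcongr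
    let c : (Fin d → Fin M) → Fin d → ℝ := fun i j => -α + (2 * ((i j : ℕ) : ℝ) + 1) * ρ
    obtain ⟨lab', hlab'⟩ := exists_label_refine (W := W) (val := val) (c := c) (ρ := ρ)
      (Q := {x | ∀ j, |x j| ≤ α}) (R := 8 * (a / (2 ^ J) ^ k)) hb
      (le_of_eq (by rw [hbdef, pow_succ, mul_pow]; field_simp; ring))
      (fun x hx => by
        choose i hi using fun j => exists_grid_center hα hM0 (hx j)
        refine ⟨i, ⟨ρ⁻¹ • (x - c i), ?_⟩, ?_⟩
        · rw [mem_closedBall_zero_iff, norm_smul, norm_inv, Real.norm_eq_abs, abs_of_pos hρ0,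
            inv_mul_le_iff₀ hρ0, mul_one, pi_norm_le_iff_of_nonneg hρ0.le]
          exact hi
        · simp [smul_smul, hρ0.ne'])
      (fun i y j => by
        have hy : |(y : Fin d → ℝ) j| ≤ 1 :=
          (norm_le_pi_norm (y : Fin d → ℝ) j).trans (mem_closedBall_zero_iff.1 y.2)
        have hi : (((i j : ℕ) : ℝ)) + 1 ≤ M := by exact_mod_cast (i j).2
        have hi0 : (0 : ℝ) ≤ ((i j : ℕ) : ℝ) := Nat.cast_nonneg _
        simp only [c, Pi.add_apply, Pi.smul_apply, smul_eq_mul]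
        rw [abs_le] at *
        constructor <;> nlinarith)
      (fun f i => by
        obtain ⟨P, hP, hPb⟩ := hpoly f (c i) ρ hρ0.le hΛρ1
        exact ⟨P, hP, fun y => (hPb y).trans hbρ⟩)
      hplab hlab
    refine ⟨_, lab', ?_, hlab'⟩
    have hcard : Fintype.card (Fin d → Fin M) = M ^ d := by simp
    rw [hcard]
    have hexp : 2 * (m * 2 ^ J) ^ d + M ^ d ≤ 2 * M ^ d := by
      have h1 : M ^ d = 2 ^ d * (m * 2 ^ J) ^ d := by rw [hM, ← mul_pow]; ring
      have h2 : 2 ≤ 2 ^ d := le_self_pow₀ one_le_two hd.ne'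
      nlinarith [Nat.mul_le_mul_right ((m * 2 ^ J) ^ d) h2]
    calc N * T ^ M ^ d ≤ T ^ (2 * (m * 2 ^ J) ^ d) * T ^ M ^ d := Nat.mul_le_mul_right _ hN
      _ = T ^ (2 * (m * 2 ^ J) ^ d + M ^ d) := (pow_add ..).symm
      _ ≤ T ^ (2 * M ^ d) := Nat.pow_le_pow_right hT hexp

lemma abs_Tbeta_sub_le (β u v : ℝ) : |Tbeta β u - Tbeta β v| ≤ |u - v| := by
  unfold Tbeta
  refine (abs_max_sub_max_le_max _ _ _ _).trans ?_
  simp only [sub_self, abs_zero]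
  refine max_le (abs_nonneg _) ((abs_min_sub_min_le_max _ _ _ _).trans ?_)
  simp

lemma abs_Tbeta_mul_cubeInd_sub_le {d : ℕ} {α β u v e : ℝ} {x : Fin d → ℝ} (he : 0 ≤ e)
    (h : (∀ j, |x j| ≤ α) → |u - v| ≤ e) :
    |Tbeta β u * cubeInd d α x - Tbeta β v * cubeInd d α x| ≤ e := by
  by_cases hx : ∀ j, |x j| ≤ α
  · have : cubeInd d α x = 1 := Set.indicator_of_mem (s := {y : Fin d → ℝ | ∀ j, |y j| ≤ α}) hx _
    simpa [this] using (abs_Tbeta_sub_le β u v).trans (h hx)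
  · have : cubeInd d α x = 0 :=
      Set.indicator_of_notMem (s := {y : Fin d → ℝ | ∀ j, |y j| ≤ α}) hx _
    simpa [this] using he

lemma mean_rpow_le {n : ℕ} (hn : 0 < n) {p e : ℝ} (hp : 0 < p) (he : 0 ≤ e) {a : Fin n → ℝ}
    (ha : ∀ s, |a s| ≤ e) : ((1 / (n : ℝ)) * ∑ s, |a s| ^ p) ^ (1 / p) ≤ e := by
  have hn' : (0 : ℝ) < n := by exact_mod_cast hn
  have hsum : ∑ s, |a s| ^ p ≤ n * e ^ p := by
    simpa using Finset.sum_le_card_nsmul Finset.univ (fun s => |a s| ^ p) (e ^ p) fun s _ =>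
      Real.rpow_le_rpow (abs_nonneg _) (ha s) hp.le
  have hmean : (1 / (n : ℝ)) * ∑ s, |a s| ^ p ≤ e ^ p := by
    rw [one_div, inv_mul_le_iff₀ hn']
    exact hsum
  have h0 : 0 ≤ (1 / (n : ℝ)) * ∑ s, |a s| ^ p :=
    mul_nonneg (by positivity) (Finset.sum_nonneg fun s _ => by positivity)
  calc _ ≤ (e ^ p) ^ (1 / p) := Real.rpow_le_rpow h0 hmean (by positivity)
    _ = e := by rw [one_div, Real.rpow_rpow_inv he hp.ne']

/-- A dyadic scale at which an error of size `8 * a` is reduced to `e`. -/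
lemma exists_dyadic_scale {k : ℕ} (hk : 0 < k) {a e : ℝ} (he : 0 < e) (hae : e ≤ 8 * a) :
    ∃ J : ℕ, 8 * (a / (2 ^ J) ^ k) ≤ e ∧ (2 : ℝ) ^ J ≤ 2 * (8 * a / e) ^ (1 / (k : ℝ)) := by
  have h1 : 1 ≤ 8 * a / e := by rwa [one_le_div he]
  have hY : 1 ≤ (8 * a / e) ^ (1 / (k : ℝ)) := Real.one_le_rpow h1 (by positivity)
  obtain ⟨n, hn1, hn2⟩ := exists_nat_pow_near hY one_lt_two
  refine ⟨n + 1, ?_, ?_⟩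
  · have h2 : 8 * a / e ≤ (2 ^ (n + 1)) ^ k := by
      calc 8 * a / e = ((8 * a / e) ^ (1 / (k : ℝ))) ^ k := by
            rw [one_div, Real.rpow_inv_natCast_pow (by linarith) hk.ne']
        _ ≤ _ := pow_le_pow_left₀ (by linarith) hn2.le k
    rw [div_le_iff₀ he] at h2
    rw [← mul_div_assoc, div_le_iff₀ (by positivity)]
    linarith
  · rw [pow_succ]
    linarith

/-- Lemma 4: covering number bound for the class of truncated networks. -/
theorem covering_number_bound
    (d r L k : ℕ) (hd : 0 < d) (hL : 2 ≤ L) (hr : 2 * d ≤ r) (hk : 0 < k)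
    (σ : ℝ → ℝ) (hσ : ContDiff ℝ k σ)
    (hσbdd : ∀ i ≤ k, ∃ M, ∀ x, |iteratedDeriv i σ x| ≤ M)
    (p : ℝ) (hp : 1 ≤ p) :
    ∃ c11 c12 c13 : ℝ, 0 < c11 ∧ 0 < c12 ∧ 0 < c13 ∧
      ∀ (Kn n : ℕ), 0 < n →
      ∀ (α β A B C ε : ℝ), 1 ≤ α → 0 < β → 1 ≤ A → 1 ≤ B → 1 ≤ C → 0 < ε → ε < β →
      ∀ (x : Fin n → Fin d → ℝ),
        ∃ (N : ℕ) (g : Fin N → (Fin d → ℝ) → ℝ),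
          (N : ℝ) ≤ (c11 * β ^ p / ε ^ p) ^
              (c12 * α ^ d * B ^ ((L - 1) * d) * A ^ d * (C / ε) ^ ((d : ℝ) / k) + c13) ∧
          ∀ w : EuclideanSpace ℝ (Idx Kn L r d),
            (∑ j : Fin Kn, |w (Sum.inr (Sum.inr j))|) ≤ C →
            (∀ (k' : Fin Kn) (l : Fin (L - 1)) (i : Fin r) (j : Fin r),
              |w (Sum.inr (Sum.inl (k', l, i, j.succ)))| ≤ B) →
            (∀ (k' : Fin Kn) (i : Fin r) (j : Fin d),
              |w (Sum.inl (k', i, j.succ))| ≤ A) →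
            ∃ i : Fin N,
              ((1 / (n : ℝ)) * ∑ s : Fin n,
                  |Tbeta β (netF σ Kn L r d w (x s)) * cubeInd d α (x s) -
                      g i (x s)| ^ p) ^ (1 / p) < ε := by
  obtain ⟨M, D, hM, hnet⟩ := exists_netF_bound hk hσ hσbdd L r d
  obtain ⟨T, hT, hlabel⟩ := exists_label_bound hd D k
  have hT' : (1 : ℝ) ≤ T := by exact_mod_cast hT
  have hM0 : 0 < M := by linarith
  have hp0 : 0 < p := by linarith
  refine ⟨T, 2 * 4 ^ d * (16 * M) ^ ((d : ℝ) / k), 1, by linarith, by positivity, one_pos,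
    fun Kn n hn α β A B C ε hα hβ hA hB hC hε hεβ x => ?_⟩
  have hX : (T : ℝ) ≤ T * β ^ p / ε ^ p := by
    rw [mul_div_assoc, ← Real.div_rpow hβ.le hε.le]
    exact le_mul_of_one_le_right (by linarith)
      (Real.one_le_rpow ((one_le_div hε).2 hεβ.le) hp0.le)
  set X : ℝ := T * β ^ p / ε ^ p
  set E : ℝ := 2 * 4 ^ d * (16 * M) ^ ((d : ℝ) / k) * α ^ d * B ^ ((L - 1) * d) * A ^ d *
    (C / ε) ^ ((d : ℝ) / k) with hE
  have hE0 : 0 ≤ E := by positivity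
  have hX1 : 1 ≤ X := hT'.trans hX
  let W : Type := {w : EuclideanSpace ℝ (Idx Kn L r d) //
    (∑ j : Fin Kn, |w (Sum.inr (Sum.inr j))|) ≤ C ∧
    (∀ (k' : Fin Kn) (l : Fin (L - 1)) (i : Fin r) (j : Fin r),
      |w (Sum.inr (Sum.inl (k', l, i, j.succ)))| ≤ B) ∧
    (∀ (k' : Fin Kn) (i : Fin r) (j : Fin d), |w (Sum.inl (k', i, j.succ))| ≤ A)}
  have : Nonempty W := ⟨⟨0, by
    have hA0 : 0 ≤ A := by linarith
    have hB0 : 0 ≤ B := by linarith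
    have hC0 : 0 ≤ C := by linarith
    simp [hA0, hB0, hC0]⟩⟩
  let val : W → (Fin d → ℝ) → ℝ := fun w => netF σ Kn L r d w.1
  have hW := fun w : W => hnet Kn w.1 A B C hA hB w.2.1 w.2.2.1 w.2.2.2
  have hcover : ∃ (N : ℕ) (lab : W → Fin N), (N : ℝ) ≤ X ^ (E + 1) ∧
      ∀ f g, lab f = lab g → ∀ z : Fin d → ℝ, (∀ j, |z j| ≤ α) →
        |val f z - val g z| ≤ ε / 2 := by
    rcases le_total (8 * (C * M)) (ε / 2) with hsmall | hlarge
    · refine ⟨1, fun _ => 0, ?_, fun f g _ z _ => ?_⟩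
      · rw [Nat.cast_one]
        exact Real.one_le_rpow hX1 (by linarith)
      · have h1 := (hW f).1 z
        have h2 := (hW g).1 z
        have h3 : 0 < C * M := by positivity
        rw [abs_le] at *
        constructor <;> linarith
    · obtain ⟨J, hJ1, hJ2⟩ := exists_dyadic_scale hk (half_pos hε) hlarge
      have hαΛ : 1 ≤ α * (A * B ^ (L - 1)) :=
        one_le_mul_of_one_le_of_one_le hα
          (one_le_mul_of_one_le_of_one_le hA (one_le_pow₀ hB))
      set m : ℕ := ⌈α * (A * B ^ (L - 1))⌉₊
      have hm : (m : ℝ) ≤ 2 * (α * (A * B ^ (L - 1))) := by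
        have := Nat.ceil_lt_add_one (zero_le_one.trans hαΛ)
        linarith
      obtain ⟨N, lab, hN, hlab⟩ := hlabel W val (C * M) (A * B ^ (L - 1)) α m (by positivity)
        (by linarith) (Nat.ceil_pos.2 (by linarith)) (by positivity) (Nat.le_ceil _)
        (fun f => (hW f).1) (fun f => (hW f).2) J
      refine ⟨N, lab, ?_, fun f g hfg z hz => (hlab f g hfg z hz).trans hJ1⟩
      have hexp : ((2 * (m * 2 ^ J) ^ d : ℕ) : ℝ) ≤ E := by
        push_cast
        calc 2 * ((m : ℝ) * 2 ^ J) ^ d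
            ≤ 2 * (2 * (α * (A * B ^ (L - 1))) *
                (2 * (8 * (C * M) / (ε / 2)) ^ (1 / (k : ℝ)))) ^ d := by gcongr
          _ = E := by
            have h1 : 8 * (C * M) / (ε / 2) = 16 * M * (C / ε) := by
              field_simp
              ring
            have h2 : ((16 * M * (C / ε)) ^ (1 / (k : ℝ))) ^ d =
                (16 * M) ^ ((d : ℝ) / k) * (C / ε) ^ ((d : ℝ) / k) := by
              rw [← Real.rpow_mul_natCast (by positivity),
                Real.mul_rpow (by positivity) (by positivity), one_div_mul_eq_div]
            rw [h1, mul_pow, mul_pow 2 (_ ^ _) d, h2, hE, pow_mul]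
            have h3 : (4 : ℝ) ^ d = 2 ^ d * 2 ^ d := by rw [← mul_pow]; norm_num
            rw [h3]
            ring
      calc (N : ℝ) ≤ (T : ℝ) ^ (2 * (m * 2 ^ J) ^ d) := by exact_mod_cast hN
        _ ≤ X ^ (2 * (m * 2 ^ J) ^ d) := pow_le_pow_left₀ (by linarith) hX _
        _ = X ^ ((2 * (m * 2 ^ J) ^ d : ℕ) : ℝ) := (Real.rpow_natCast _ _).symm
        _ ≤ X ^ (E + 1) := Real.rpow_le_rpow_of_exponent_le hX1 (by linarith)
  obtain ⟨N, lab, hN, hlab⟩ := hcover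
  refine ⟨N, fun i z => Tbeta β (val (Function.invFun lab i) z) * cubeInd d α z, hN,
    fun w hwC hwB hwA => ⟨lab ⟨w, hwC, hwB, hwA⟩, ?_⟩⟩
  refine (mean_rpow_le hn hp0 (half_pos hε).le fun s => ?_).trans_lt (half_lt_self hε)
  exact abs_Tbeta_mul_cubeInd_sub_le (half_pos hε).le fun hs =>
    hlab ⟨w, hwC, hwB, hwA⟩ _ (Function.invFun_eq ⟨_, rfl⟩).symm (x s) hs

end
end

section
/- Let σ(x) = 1/(1+e^{−x}) be the logistic squasher, let 0 < δ ≤ 1, 1 ≤ α_n ≤ log n, and let u, v ∈ ℝ^d satisfy v^{(l)} − u^{(l)} ≥ 2δ for l ∈ {1,…,d}. Let L, r, n ∈ ℕ with L ≥ 2, r ≥ 2d, n ≥ 8d and n ≥ exp(r+1). Let f_w = f^{(L)}_{1,1} be a single fully connected network and define the weight vector w by: w^{(0)}_{1,j,j} = 4d(log n)²/δ and w^{(0)}_{1,j,0} = −(4d(log n)²/δ)·u^{(j)} for j ∈ {1,…,d}; w^{(0)}_{1,j+d,j} = −4d(log n)²/δ and w^{(0)}_{1,j+d,0} = (4d(log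 n)²/δ)·v^{(j)} for j ∈ {1,…,d}; w^{(0)}_{1,s,t} = 0 if s ≤ 2d, s ≠ t, s ≠ t+d and t > 0; w^{(1)}_{1,1,t} = 8(log n)² for t ∈ {1,…,2d}; w^{(1)}_{1,1,0} = −8(log n)²·(2d − 1/2); w^{(1)}_{1,1,t} = 0 for t > 2d; w^{(l)}_{1,1,1} = 6(log n)² for l ∈ {2,…,L}; w^{(l)}_{1,1,0} = −3(log n)² for l ∈ {2,…,L}; and w^{(l)}_{1,1,t} = 0 for t > 1 and l ∈ {2,…,L}. Let w̄ be any weight vector with |w̄^{(l)}_{1,i,j} − w^{(l)}_{1,i,j}| ≤ log n for all l = 0,…,L−1. Then for all x ∈ [−α_n,α_n]^d: f_{w̄}(x) ≥ 1 − 1/n if x ∈ [u^{(1)}+δ, v^{(1)}−δ] × ⋯ × [u^{(d)}+δ, v^{(d)}−δ], and f_{w̄}(x) ≤ 1/n if x^{(i)} ∉ [u^{(i)}−δ, v^{(i)}+δ] for some i ∈ {1,…,d}. -/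
open MeasureTheory ProbabilityTheory Filter

noncomputable section

/-- The weight conditions of Lemma 5: the `k`-th fully connected subnetwork of `w`
implements an approximation of the indicator of the cube
`[u^{(1)},v^{(1)}) × ⋯ × [u^{(d)},v^{(d)})` at resolution `δ`.
(Paper neuron/level `j ∈ {1,…}` corresponds to `Fin`-index `j - 1`.) -/
def ImplementsCube (Kn L r d n : ℕ) (δ : ℝ) (u v : Fin d → ℝ)
    (w : EuclideanSpace ℝ (Idx Kn L r d)) (k : Fin Kn) : Prop :=
  -- level 0, neurons 1,…,d
  (∀ (i : Fin r) (j : Fin d), (i : ℕ) = (j : ℕ) →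
      w (Sum.inl (k, i, j.succ)) = 4 * d * Real.log n ^ 2 / δ ∧
      w (Sum.inl (k, i, 0)) = -(4 * d * Real.log n ^ 2 / δ) * u j) ∧
  -- level 0, neurons d+1,…,2d
  (∀ (i : Fin r) (j : Fin d), (i : ℕ) = (j : ℕ) + d →
      w (Sum.inl (k, i, j.succ)) = -(4 * d * Real.log n ^ 2 / δ) ∧
      w (Sum.inl (k, i, 0)) = (4 * d * Real.log n ^ 2 / δ) * v j) ∧
  -- remaining level-0 weights of the first 2d neurons vanish
  (∀ (i : Fin r) (t : Fin d), (i : ℕ) < 2 * d → (i : ℕ) ≠ (t : ℕ) →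
      (i : ℕ) ≠ (t : ℕ) + d → w (Sum.inl (k, i, t.succ)) = 0) ∧
  -- level 1 (inner level index 0)
  (∀ m : Fin (L - 1), (m : ℕ) = 0 → ∀ i0 : Fin r, (i0 : ℕ) = 0 →
      (∀ t : Fin r, (t : ℕ) < 2 * d →
        w (Sum.inr (Sum.inl (k, m, i0, t.succ))) = 8 * Real.log n ^ 2) ∧
      w (Sum.inr (Sum.inl (k, m, i0, 0))) = -(8 * Real.log n ^ 2) * (2 * d - 1 / 2) ∧
      (∀ t : Fin r, 2 * d ≤ (t : ℕ) →
        w (Sum.inr (Sum.inl (k, m, i0, t.succ))) = 0)) ∧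
  -- levels 2,…,L-1 (inner level indices 1,…,L-2)
  (∀ m : Fin (L - 1), 1 ≤ (m : ℕ) → ∀ i0 : Fin r, (i0 : ℕ) = 0 →
      (∀ t : Fin r, ((t : ℕ) = 0 →
          w (Sum.inr (Sum.inl (k, m, i0, t.succ))) = 6 * Real.log n ^ 2) ∧
        (1 ≤ (t : ℕ) → w (Sum.inr (Sum.inl (k, m, i0, t.succ))) = 0)) ∧
      w (Sum.inr (Sum.inl (k, m, i0, 0))) = -(3 * Real.log n ^ 2))

/-- All level-0 and inner weights of the `k`-th subnetwork of `wb` are within `c` of the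
corresponding weights of `w`. -/
def InnerClose (Kn L r d : ℕ) (w wb : EuclideanSpace ℝ (Idx Kn L r d)) (k : Fin Kn)
    (c : ℝ) : Prop :=
  (∀ (i : Fin r) (j : Fin (d + 1)),
    |wb (Sum.inl (k, i, j)) - w (Sum.inl (k, i, j))| ≤ c) ∧
  (∀ (m : Fin (L - 1)) (i : Fin r) (j : Fin (r + 1)),
    |wb (Sum.inr (Sum.inl (k, m, i, j))) - w (Sum.inr (Sum.inl (k, m, i, j)))| ≤ c)

theorem sigLog_nonneg (z : ℝ) : 0 ≤ sigLog z := by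
  unfold sigLog; positivity

theorem sigLog_le_one (z : ℝ) : sigLog z ≤ 1 := by
  unfold sigLog
  rw [div_le_one (by positivity)]
  linarith [Real.exp_pos (-z)]

theorem one_sub_exp_neg_le_sigLog (z : ℝ) : 1 - Real.exp (-z) ≤ sigLog z := by
  unfold sigLog
  rw [le_div_iff₀ (by positivity)]
  nlinarith [sq_nonneg (Real.exp (-z))]

theorem sigLog_le_exp (z : ℝ) : sigLog z ≤ Real.exp z := by
  unfold sigLog
  rw [div_le_iff₀ (by positivity), mul_add, ← Real.exp_add, add_neg_cancel, Real.exp_zero]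
  linarith [Real.exp_pos z]

theorem one_sub_inv_le_sigLog {a z : ℝ} (ha : 0 < a) (hz : Real.log a ≤ z) :
    1 - 1 / a ≤ sigLog z := by
  have h : Real.exp (-z) ≤ 1 / a := by
    rw [one_div, ← Real.exp_log (inv_pos.2 ha), Real.log_inv]
    exact Real.exp_le_exp.2 (by linarith)
  linarith [one_sub_exp_neg_le_sigLog z]

theorem sigLog_le_inv {a z : ℝ} (ha : 0 < a) (hz : z ≤ -Real.log a) :
    sigLog z ≤ 1 / a := by
  refine (sigLog_le_exp z).trans ?_
  rw [one_div, ← Real.exp_log (inv_pos.2 ha), Real.log_inv]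
  exact Real.exp_le_exp.2 hz

theorem hid_sigLog_mem_Icc (Kn L r d : ℕ) (w : EuclideanSpace ℝ (Idx Kn L r d)) (k : Fin Kn)
    (m : ℕ) (i : Fin r) (x : Fin d → ℝ) :
    hid sigLog Kn L r d w k m i x ∈ Set.Icc 0 1 := by
  cases m <;> exact ⟨sigLog_nonneg _, sigLog_le_one _⟩

/-- An affine form evaluated at a point of sup norm at most `B` moves by at most `c * (k * B + 1)`
when each of its coefficients moves by at most `c`. -/
theorem abs_affine_sub_affine_le {k : ℕ} {a a' y : Fin k → ℝ} {a₀ a₀' B c : ℝ} (hc : 0 ≤ c)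
    (ha : ∀ j, |a' j - a j| ≤ c) (ha₀ : |a₀' - a₀| ≤ c) (hy : ∀ j, |y j| ≤ B) :
    |((∑ j, a' j * y j) + a₀') - ((∑ j, a j * y j) + a₀)| ≤ c * (k * B + 1) := by
  have h₁ : ((∑ j, a' j * y j) + a₀') - ((∑ j, a j * y j) + a₀) =
      (∑ j, (a' j - a j) * y j) + (a₀' - a₀) := by
    simp only [sub_mul, Finset.sum_sub_distrib]; ring
  have h₂ : |∑ j, (a' j - a j) * y j| ≤ k * (c * B) := by
    refine (Finset.abs_sum_le_sum_abs _ _).trans ?_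
    refine (Finset.sum_le_card_nsmul _ _ (c * B) fun j _ => ?_).trans (by simp)
    rw [abs_mul]
    exact mul_le_mul (ha j) (hy j) (abs_nonneg _) hc
  rw [h₁]
  refine (abs_add_le _ _).trans ?_
  linarith

section Layers

variable {d L r n : ℕ} {δ : ℝ} {u v : Fin d → ℝ} {w wb : EuclideanSpace ℝ (Idx 1 L r d)}
  {x : Fin d → ℝ}

theorem hid_zero_eq_lower (hw : ImplementsCube 1 L r d n δ u v w 0)
    (hclose : InnerClose 1 L r d w wb 0 (Real.log n)) (hx : ∀ i, |x i| ≤ Real.log n)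
    {i : Fin r} {j : Fin d} (hij : (i : ℕ) = j) :
    ∃ z, hid sigLog 1 L r d wb 0 0 i x = sigLog z ∧
      |z - 4 * d * Real.log n ^ 2 / δ * (x j - u j)| ≤
        Real.log n * (d * Real.log n + 1) := by
  refine ⟨_, rfl, ?_⟩
  have h := abs_affine_sub_affine_le ((abs_nonneg _).trans (hx j))
    (fun t => hclose.1 i t.succ) (hclose.1 i 0) hx
  convert h using 3
  rw [Finset.sum_eq_single j, (hw.1 i j hij).1, (hw.1 i j hij).2]
  · ring
  · intro t _ ht
    have := Fin.val_ne_of_ne ht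
    rw [hw.2.2.1 i t (by omega) (by omega) (by omega), zero_mul]
  · simp

theorem hid_zero_eq_upper (hw : ImplementsCube 1 L r d n δ u v w 0)
    (hclose : InnerClose 1 L r d w wb 0 (Real.log n)) (hx : ∀ i, |x i| ≤ Real.log n)
    {i : Fin r} {j : Fin d} (hij : (i : ℕ) = j + d) :
    ∃ z, hid sigLog 1 L r d wb 0 0 i x = sigLog z ∧
      |z - 4 * d * Real.log n ^ 2 / δ * (v j - x j)| ≤
        Real.log n * (d * Real.log n + 1) := by
  refine ⟨_, rfl, ?_⟩
  have h := abs_affine_sub_affine_le ((abs_nonneg _).trans (hx j))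
    (fun t => hclose.1 i t.succ) (hclose.1 i 0) hx
  convert h using 3
  rw [Finset.sum_eq_single j, (hw.2.1 i j hij).1, (hw.2.1 i j hij).2]
  · ring
  · intro t _ ht
    have := Fin.val_ne_of_ne ht
    rw [hw.2.2.1 i t (by omega) (by omega) (by omega), zero_mul]
  · simp

theorem hid_succ_eq (hlog : 0 ≤ Real.log n)
    (hclose : InnerClose 1 L r d w wb 0 (Real.log n)) (m : Fin (L - 1)) (i : Fin r) :
    ∃ z, hid sigLog 1 L r d wb 0 (m + 1) i x = sigLog z ∧
      |z - ((∑ t : Fin r, w (Sum.inr (Sum.inl (0, m, i, t.succ))) *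
          hid sigLog 1 L r d wb 0 m t x) + w (Sum.inr (Sum.inl (0, m, i, 0))))| ≤
        Real.log n * (r + 1) := by
  refine ⟨_, rfl, ?_⟩
  have h := abs_affine_sub_affine_le hlog (fun t => hclose.2 m i t.succ) (hclose.2 m i 0)
    (fun t => abs_le.2 ⟨by linarith [(hid_sigLog_mem_Icc 1 L r d wb 0 m t x).1],
      (hid_sigLog_mem_Icc 1 L r d wb 0 m t x).2⟩)
  simpa using h

theorem hid_one_eq (hlog : 0 ≤ Real.log n) (hL : 2 ≤ L)
    (hw : ImplementsCube 1 L r d n δ u v w 0)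
    (hclose : InnerClose 1 L r d w wb 0 (Real.log n)) {i : Fin r} (hi : (i : ℕ) = 0) :
    ∃ z, hid sigLog 1 L r d wb 0 1 i x = sigLog z ∧
      |z - 8 * Real.log n ^ 2 * ((∑ t : Fin r with t.val < 2 * d,
          hid sigLog 1 L r d wb 0 0 t x) - (2 * d - 1 / 2))| ≤
        Real.log n * (r + 1) := by
  obtain ⟨z, hz, hzw⟩ := hid_succ_eq (x := x) hlog hclose ⟨0, by omega⟩ i
  refine ⟨z, hz, ?_⟩
  obtain ⟨h₁, h₀, h₂⟩ := hw.2.2.2.1 ⟨0, by omega⟩ rfl i hi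
  convert hzw using 3
  rw [h₀, mul_sub, Finset.mul_sum, Finset.sum_filter, neg_mul, ← sub_eq_add_neg]
  congr 1
  refine Finset.sum_congr rfl fun t _ => ?_
  split_ifs with ht
  · rw [h₁ t ht]
  · rw [h₂ t (by omega), zero_mul]

theorem hid_add_two_eq (hlog : 0 ≤ Real.log n)
    (hw : ImplementsCube 1 L r d n δ u v w 0)
    (hclose : InnerClose 1 L r d w wb 0 (Real.log n)) {i : Fin r} (hi : (i : ℕ) = 0)
    {m : ℕ} (hm : m + 1 < L - 1) :
    ∃ z, hid sigLog 1 L r d wb 0 (m + 2) i x = sigLog z ∧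
      |z - 6 * Real.log n ^ 2 * (hid sigLog 1 L r d wb 0 (m + 1) i x - 1 / 2)| ≤
        Real.log n * (r + 1) := by
  obtain ⟨z, hz, hzw⟩ := hid_succ_eq (x := x) hlog hclose ⟨m + 1, hm⟩ i
  refine ⟨z, hz, ?_⟩
  obtain ⟨h₁, h₀⟩ := hw.2.2.2.2 ⟨m + 1, hm⟩ (by simp) i hi
  convert hzw using 3
  rw [h₀, Finset.sum_eq_single i, (h₁ i).1 hi]
  · ring
  · intro t _ ht
    have := Fin.val_ne_of_ne ht
    rw [(h₁ t).2 (by omega), zero_mul]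
  · simp

/-- From the second layer on, the first neuron preserves both saturation bounds. -/
theorem hid_succ_saturated (hr : (r : ℝ) + 1 ≤ Real.log n) (hn : (8 : ℝ) ≤ n)
    (hw : ImplementsCube 1 L r d n δ u v w 0)
    (hclose : InnerClose 1 L r d w wb 0 (Real.log n)) {i : Fin r} (hi : (i : ℕ) = 0)
    {m : ℕ} (hm : m < L - 1) :
    (1 - 1 / (n : ℝ) ≤ hid sigLog 1 L r d wb 0 1 i x →
      1 - 1 / (n : ℝ) ≤ hid sigLog 1 L r d wb 0 (m + 1) i x) ∧
    (hid sigLog 1 L r d wb 0 1 i x ≤ 1 / n →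
      hid sigLog 1 L r d wb 0 (m + 1) i x ≤ 1 / n) := by
  have hn0 : (0 : ℝ) < n := by linarith
  have hlog : 1 ≤ Real.log n := by linarith [Nat.cast_nonneg (α := ℝ) r]
  have hinv : 1 / (n : ℝ) ≤ 1 / 8 := one_div_le_one_div_of_le (by norm_num) hn
  induction m with
  | zero => exact ⟨id, id⟩
  | succ m ih =>
    obtain ⟨z, hz, hzw⟩ := hid_add_two_eq (x := x) (by linarith) hw hclose hi hm
    obtain ⟨hlo, hup⟩ := abs_le.1 hzw
    rw [hz]
    obtain ⟨ih₁, ih₂⟩ := ih (by omega)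
    constructor
    · intro h
      apply one_sub_inv_le_sigLog hn0
      have := ih₁ h
      nlinarith
    · intro h
      apply sigLog_le_inv hn0
      have := ih₂ h
      nlinarith

end Layers

/-- Lemma 5: a perturbed single fully connected network approximates the indicator of a cube. -/
theorem single_network_indicator_approximation
    (d L r n : ℕ) (hd : 0 < d) (hL : 2 ≤ L) (hr : 2 * d ≤ r)
    (hn8 : 8 * d ≤ n) (hnr : Real.exp (r + 1) ≤ n)
    (δ αn : ℝ) (hδ0 : 0 < δ) (hδ1 : δ ≤ 1) (hα1 : 1 ≤ αn) (hαlog : αn ≤ Real.log n)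
    (u v : Fin d → ℝ) (huv : ∀ l, 2 * δ ≤ v l - u l)
    (w wb : EuclideanSpace ℝ (Idx 1 L r d))
    (hw : ImplementsCube 1 L r d n δ u v w 0)
    (hclose : InnerClose 1 L r d w wb 0 (Real.log n))
    (x : Fin d → ℝ) (hx : ∀ i, |x i| ≤ αn) :
    ((∀ i, u i + δ ≤ x i ∧ x i ≤ v i - δ) →
      1 - 1 / n ≤ subnet sigLog 1 L r d wb 0 x) ∧
    ((∃ i, x i < u i - δ ∨ v i + δ < x i) →
      subnet sigLog 1 L r d wb 0 x ≤ 1 / n) := by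
  have hlogr : (r : ℝ) + 1 ≤ Real.log n := by
    rw [← Real.log_exp ((r : ℝ) + 1)]
    exact Real.log_le_log (Real.exp_pos _) hnr
  have hd1 : (1 : ℝ) ≤ d := by exact_mod_cast hd
  have hlog : 1 ≤ Real.log n := by linarith
  have hn8' : 8 * (d : ℝ) ≤ n := by exact_mod_cast hn8
  have hn : (8 : ℝ) ≤ n := by linarith
  have hn0 : (0 : ℝ) < n := by linarith
  have hdn : 2 * d * (1 / (n : ℝ)) ≤ 1 / 4 := by
    rw [mul_one_div, div_le_iff₀ hn0]; linarith
  have hinv : 1 / (n : ℝ) ≤ 1 / 8 := one_div_le_one_div_of_le (by norm_num) hn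
  have hx' : ∀ i, |x i| ≤ Real.log n := fun i => (hx i).trans hαlog
  have herr : Real.log n * (d * Real.log n + 1) ≤
      4 * d * Real.log n ^ 2 - Real.log n := by nlinarith
  have hslope : 0 ≤ 4 * d * Real.log n ^ 2 / δ := by positivity
  have hslopeδ : 4 * d * Real.log n ^ 2 / δ * δ = 4 * d * Real.log n ^ 2 :=
    div_mul_cancel₀ _ hδ0.ne'
  have hsat : ∀ s : ℝ, δ ≤ s → 4 * d * Real.log n ^ 2 ≤ 4 * d * Real.log n ^ 2 / δ * s :=
    fun s hs => hslopeδ.symm.trans_le (mul_le_mul_of_nonneg_left hs hslope)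
  have hsat' : ∀ s : ℝ, s ≤ -δ → 4 * d * Real.log n ^ 2 / δ * s ≤ -(4 * d * Real.log n ^ 2) := by
    intro s hs
    linarith [hsat (-s) (by linarith)]
  have hcard : (Finset.univ.filter fun t : Fin r => t.val < 2 * d).card = 2 * d := by
    rw [Fin.card_filter_val_lt, min_eq_right hr]
  have hr0 : 0 < r := by omega
  have hL' : L - 1 = L - 2 + 1 := by omega
  obtain ⟨z, hz, hzw⟩ := hid_one_eq (x := x) (by linarith) hL hw hclose (i := ⟨0, hr0⟩) rfl
  obtain ⟨hlo, hup⟩ := abs_le.1 hzw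
  have hstep := hid_succ_saturated (x := x) hlogr hn hw hclose (i := ⟨0, hr0⟩) rfl
    (m := L - 2) (by omega)
  rw [subnet, dif_pos hr0, hL']
  constructor
  · intro h
    refine hstep.1 ?_
    rw [hz]
    apply one_sub_inv_le_sigLog hn0
    have hsum : 2 * d * (1 - 1 / (n : ℝ)) ≤ ∑ t : Fin r with t.val < 2 * d,
        hid sigLog 1 L r d wb 0 0 t x := by
      have := Finset.card_nsmul_le_sum (Finset.univ.filter fun t : Fin r => t.val < 2 * d)
        (fun t => hid sigLog 1 L r d wb 0 0 t x) (1 - 1 / (n : ℝ)) ?_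
      · rw [hcard, nsmul_eq_mul] at this
        exact_mod_cast this
      · intro t ht
        have ht : t.val < 2 * d := by simpa using ht
        by_cases htd : t.val < d
        · obtain ⟨y, hy, hyw⟩ := hid_zero_eq_lower hw hclose hx' (i := t) (j := ⟨t, htd⟩) rfl
          rw [hy]
          apply one_sub_inv_le_sigLog hn0
          linarith [(abs_le.1 hyw).1, hsat _ (le_sub_iff_add_le'.2 (h ⟨t, htd⟩).1)]
        · obtain ⟨y, hy, hyw⟩ := hid_zero_eq_upper hw hclose hx' (i := t)
            (j := ⟨t - d, by omega⟩) (by simp; omega)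
          rw [hy]
          apply one_sub_inv_le_sigLog hn0
          linarith [(abs_le.1 hyw).1, hsat _ (le_sub_comm.1 (h ⟨t - d, by omega⟩).2)]
    nlinarith
  · rintro ⟨i, hi⟩
    refine hstep.2 ?_
    rw [hz]
    apply sigLog_le_inv hn0
    obtain ⟨t, ht, hft⟩ : ∃ t : Fin r, t.val < 2 * d ∧
        hid sigLog 1 L r d wb 0 0 t x ≤ 1 / n := by
      rcases hi with hi | hi
      · refine ⟨⟨i, by omega⟩, by simp; omega, ?_⟩
        obtain ⟨y, hy, hyw⟩ := hid_zero_eq_lower hw hclose hx' (i := ⟨i, by omega⟩) (j := i) rfl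
        rw [hy]
        apply sigLog_le_inv hn0
        linarith [(abs_le.1 hyw).2, hsat' (x i - u i) (by linarith)]
      · refine ⟨⟨i + d, by omega⟩, by simp; omega, ?_⟩
        obtain ⟨y, hy, hyw⟩ := hid_zero_eq_upper hw hclose hx' (i := ⟨i + d, by omega⟩)
          (j := i) rfl
        rw [hy]
        apply sigLog_le_inv hn0
        linarith [(abs_le.1 hyw).2, hsat' (v i - x i) (by linarith)]
    have hsum : ∑ t : Fin r with t.val < 2 * d, hid sigLog 1 L r d wb 0 0 t x ≤
        2 * d - 1 + 1 / n := by
      have hle := Finset.single_le_sum (f := fun t => 1 - hid sigLog 1 L r d wb 0 0 t x)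
        (s := Finset.univ.filter fun t : Fin r => t.val < 2 * d)
        (fun t _ => sub_nonneg.2 (hid_sigLog_mem_Icc 1 L r d wb 0 0 t x).2) (a := t) (by simpa)
      rw [Finset.sum_sub_distrib, Finset.sum_const, hcard, nsmul_one] at hle
      push_cast at hle
      linarith
    nlinarith

end
end
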